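/- arXiv:1809.08169 — 5 statements merged into one kernel-verified Lean document; each statement's English description precedes it below -/
import Mathlib

section
/- Let A be an intersection type and let S be the set of all closed untyped lambda terms M such that ⊢ M : A is derivable in BCD. Then the map that takes a term in S to the Gödel number of its beta-eta normal form is representable: there exists a closed lambda term M such that for every closed beta-eta normal form N in S, M N is beta-eta convertible to the Church numeral of the Gödel number of N. -/
/-! Common definitions: untyped lambda calculus (de Bruijn), beta/eta reduction,
BCD intersection types, derivations, Böhm-tree notions, numeral systems. -/

inductive Term : Type
  | var : ℕ → Term
  | app : Term → Term → Term
  | lam : Term → Term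
  deriving DecidableEq

namespace Term

/-- Lift the free variables `≥ k` by `d`. -/
def lift (d : ℕ) : ℕ → Term → Term
  | k, var n => if n < k then var n else var (n + d)
  | k, app s t => app (lift d k s) (lift d k t)
  | k, lam t => lam (lift d (k + 1) t)

/-- Substitute `u` for the free variable `k`. -/
def subst (u : Term) : ℕ → Term → Term
  | k, var n => if n = k then lift k 0 u else if k < n then var (n - 1) else var n
  | k, app s t => app (subst u k s) (subst u k t)
  | k, lam t => lam (subst u (k + 1) t)

/-- One-step beta reduction. -/
inductive Beta : Term → Term → Prop
  | beta (t u : Term) : Beta (app (lam t) u) (subst u 0 t)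
  | appL {s s' : Term} (t : Term) : Beta s s' → Beta (app s t) (app s' t)
  | appR (s : Term) {t t' : Term} : Beta t t' → Beta (app s t) (app s t')
  | lam {t t' : Term} : Beta t t' → Beta (lam t) (lam t')

/-- One-step eta reduction. -/
inductive Eta : Term → Term → Prop
  | eta (t : Term) : Eta (lam (app (lift 1 0 t) (var 0))) t
  | appL {s s' : Term} (t : Term) : Eta s s' → Eta (app s t) (app s' t)
  | appR (s : Term) {t t' : Term} : Eta t t' → Eta (app s t) (app s t')
  | lam {t t' : Term} : Eta t t' → Eta (lam t) (lam t')

/-- One-step beta-eta reduction. -/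
def BetaEta (s t : Term) : Prop := Beta s t ∨ Eta s t

/-- Beta-eta conversion. -/
inductive Conv : Term → Term → Prop
  | rel {s t : Term} : BetaEta s t → Conv s t
  | refl (t : Term) : Conv t t
  | symm {s t : Term} : Conv s t → Conv t s
  | trans {s t u : Term} : Conv s t → Conv t u → Conv s u

/-- Beta conversion. -/
inductive BetaConv : Term → Term → Prop
  | rel {s t : Term} : Beta s t → BetaConv s t
  | refl (t : Term) : BetaConv t t
  | symm {s t : Term} : BetaConv s t → BetaConv t s
  | trans {s t u : Term} : BetaConv s t → BetaConv t u → BetaConv s u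

/-- Beta normal form. -/
def BetaNormal (t : Term) : Prop := ∀ u, ¬ Beta t u

/-- Beta-eta normal form. -/
def BetaEtaNormal (t : Term) : Prop := ∀ u, ¬ BetaEta t u

/-- Strongly normalizable (with respect to beta reduction). -/
def SN (t : Term) : Prop := Acc (fun a b => Beta b a) t

/-- All free variables are `< k`. -/
def ClosedUnder : ℕ → Term → Prop
  | k, var n => n < k
  | k, app s t => ClosedUnder k s ∧ ClosedUnder k t
  | k, lam t => ClosedUnder (k + 1) t

/-- Closed term. -/
def Closed (t : Term) : Prop := ClosedUnder 0 t

/-- Length of the outermost lambda prefix. -/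
def prefixLen : Term → ℕ
  | lam t => prefixLen t + 1
  | _ => 0

/-- Strip the outermost lambda prefix. -/
def stripPrefix : Term → Term
  | lam t => stripPrefix t
  | t => t

/-- Head variable of an application spine. -/
def spineHead : Term → Option ℕ
  | var n => some n
  | app s _ => spineHead s
  | lam _ => none

/-- Arguments of an application spine. -/
def spineArgs : Term → List Term
  | app s t => spineArgs s ++ [t]
  | _ => []

/-- Head variable of a Böhm-tree node `λ x_1 ... x_k. x t_1 ... t_l`. -/
def headOf (t : Term) : Option ℕ := spineHead (stripPrefix t)

/-- Immediate descendants (the arguments) of a Böhm-tree node. -/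
def argsOf (t : Term) : List Term := spineArgs (stripPrefix t)

/-- `Desc t d w` : `w` is a node of the Böhm tree of the beta-normal term `t`;
`d` is the number of lambdas crossed strictly above (the root of) `w`. -/
inductive Desc : Term → ℕ → Term → Prop
  | refl (t : Term) : Desc t 0 t
  | step {t u w : Term} {d : ℕ} : u ∈ argsOf t → Desc u d w →
      Desc t (prefixLen t + d) w

/-- `Osc t l` : the Böhm tree of the beta-normal term `t` contains an oscillation
of length `l` whose first pair has the root of `t` as its first coordinate:
a node `λ x⃗.x` is paired with one of the arguments `u` of this occurrence of `x`
having a non-empty lambda prefix, and the next pair (if it exists) has the head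
variable of its first coordinate `w` bound by the lambda prefix of `u`. -/
inductive Osc : Term → ℕ → Prop
  | one {t u : Term} : u ∈ argsOf t → 0 < prefixLen u → Osc t 1
  | succ {t u w : Term} {d h l : ℕ} : u ∈ argsOf t → 0 < prefixLen u →
      Desc u d w → headOf w = some h →
      prefixLen w + d ≤ h + prefixLen u → h < prefixLen w + d →
      Osc w l → Osc t (l + 1)

/-- `X` has class `n` : every lambda prefix in the Böhm tree of `X` has at most `n`
lambdas, every node has at most `n` immediate descendants, and every oscillation
has length at most `n`. -/
def HasClass (n : ℕ) (X : Term) : Prop :=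
  (∀ d w, Desc X d w → prefixLen w ≤ n ∧ (argsOf w).length ≤ n) ∧
  (∀ d w l, Desc X d w → Osc w l → l ≤ n)

/-- Depth of the Böhm tree of a beta-normal term. -/
def tdepth : Term → ℕ
  | var _ => 0
  | lam t => tdepth t
  | app s t => max (tdepth s) (tdepth t + 1)

end Term

/-- `iterApp f n x = f (f ( ... (f x)))`, `n` times. -/
def iterApp (f : Term) : ℕ → Term → Term
  | 0, x => x
  | n + 1, x => Term.app f (iterApp f n x)

/-- Church numeral. -/
def church (n : ℕ) : Term := Term.lam (Term.lam (iterApp (Term.var 1) n (Term.var 0)))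

/-- A fixed effective Gödel numbering of lambda terms. -/
def gnum : Term → ℕ
  | Term.var n => Nat.pair 0 n
  | Term.app s t => Nat.pair 1 (Nat.pair (gnum s) (gnum t))
  | Term.lam t => Nat.pair 2 (gnum t)

/-- Intersection types (no top element). -/
inductive Ty : Type
  | atom : ℕ → Ty
  | arrow : Ty → Ty → Ty
  | inter : Ty → Ty → Ty
  deriving DecidableEq

namespace Ty

/-- The subtype preorder on intersection types (the "Traditional" system). -/
inductive Sub : Ty → Ty → Prop
  | refl (A : Ty) : Sub A A
  | trans {A B C : Ty} : Sub A B → Sub B C → Sub A C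
  | interL (A B : Ty) : Sub (inter A B) A
  | interR (A B : Ty) : Sub (inter A B) B
  | interGlb {C A B : Ty} : Sub C A → Sub C B → Sub C (inter A B)
  | arrow {A B C D : Ty} : Sub A C → Sub D B → Sub (arrow C D) (arrow A B)
  | dist (A B C : Ty) : Sub (inter (arrow A B) (arrow A C)) (arrow A (inter B C))

def IsInter : Ty → Prop
  | inter _ _ => True
  | _ => False

/-- Dist normal form: no subexpression of the shape `A → (B ∧ C)`. -/
def Dnf : Ty → Prop
  | atom _ => True
  | arrow A B => Dnf A ∧ Dnf B ∧ ¬ IsInter B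
  | inter A B => Dnf A ∧ Dnf B

/-- `occ a s A` : the number of occurrences of the atom `a` in `A` whose sign is `s`
(`true` = positive, `false` = negative); signs are preserved in the right argument
of `→` and in both arguments of `∧`, and flipped in the left argument of `→`. -/
def occ (a : ℕ) : Bool → Ty → ℕ
  | s, atom b => if s then (if a = b then 1 else 0) else 0
  | s, arrow C B => occ a (!s) C + occ a s B
  | s, inter C B => occ a s C + occ a s B

/-- `interOcc s A` : the number of occurrences of `∧` in `A` with sign `s`. -/
def interOcc : Bool → Ty → ℕ
  | _, atom _ => 0
  | s, arrow C B => interOcc (!s) C + interOcc s B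
  | s, inter C B => (if s then 1 else 0) + interOcc s C + interOcc s B

/-- A type in dnf is functional if each atom occurs at most twice, any two
occurrences of the same atom have opposite sign, and `∧` has no positive
occurrence. -/
def Functional (A : Ty) : Prop :=
  Dnf A ∧ (∀ a, occ a true A ≤ 1 ∧ occ a false A ≤ 1) ∧ interOcc true A = 0

/-- Co-functional: as `Functional` but `∧` has no negative occurrence. -/
def CoFunctional (A : Ty) : Prop :=
  Dnf A ∧ (∀ a, occ a true A ≤ 1 ∧ occ a false A ≤ 1) ∧ interOcc false A = 0

/-- Tropical evaluation of a type at the valuation `v` of the atom variables, at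
sign `s`; `te v true A` is `e(A)` and `te v false A` is its dual `~e(A)`. -/
def te (v : ℕ → ℕ) : Bool → Ty → ℕ
  | _, atom a => v a
  | s, arrow C B => 1 + te v (!s) C + te v s B
  | s, inter C B => if s then min (te v s C) (te v s B) else max (te v s C) (te v s B)

/-- slat congruence : the congruence generated by associativity and commutativity
of `∧` and idempotence `A ~ A ∧ A`. -/
inductive Slat : Ty → Ty → Prop
  | refl (A : Ty) : Slat A A
  | symm {A B : Ty} : Slat A B → Slat B A
  | trans {A B C : Ty} : Slat A B → Slat B C → Slat A C
  | assoc (A B C : Ty) : Slat (inter A (inter B C)) (inter (inter A B) C)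
  | comm (A B : Ty) : Slat (inter A B) (inter B A)
  | idem (A : Ty) : Slat A (inter A A)
  | arrowCong {A A' B B' : Ty} : Slat A A' → Slat B B' → Slat (arrow A B) (arrow A' B')
  | interCong {A A' B B' : Ty} : Slat A A' → Slat B B' → Slat (inter A B) (inter A' B')

/-- The `i`-th argument type along the arrows of a type. -/
def argTy : Ty → ℕ → Option Ty
  | arrow A _, 0 => some A
  | arrow _ B, n + 1 => argTy B n
  | _, _ => none

/-- The principal atoms (the end atoms of the components) of a type in dnf. -/
def principalAtoms : Ty → List ℕ
  | atom a => [a]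
  | arrow _ B => principalAtoms B
  | inter A B => principalAtoms A ++ principalAtoms B

/-- All atoms occurring in a type. -/
def atoms : Ty → List ℕ
  | atom a => [a]
  | arrow A B => atoms A ++ atoms B
  | inter A B => atoms A ++ atoms B

/-- `arrows [A₁, ..., Aₙ] B = A₁ → ( ... (Aₙ → B) ...)`. -/
def arrows (l : List Ty) (b : Ty) : Ty := l.foldr Ty.arrow b

end Ty

/-- One-hole contexts for types. -/
inductive Ctx : Type
  | hole : Ctx
  | arrowL : Ctx → Ty → Ctx
  | arrowR : Ty → Ctx → Ctx
  | interL : Ctx → Ty → Ctx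
  | interR : Ty → Ctx → Ctx

namespace Ctx

/-- Fill the hole of a context with a type. -/
def fill : Ctx → Ty → Ty
  | hole, A => A
  | arrowL C B, A => Ty.arrow (fill C A) B
  | arrowR B C, A => Ty.arrow B (fill C A)
  | interL C B, A => Ty.inter (fill C A) B
  | interR B C, A => Ty.inter B (fill C A)

/-- Sign of the hole of a context (`true` = positive occurrence). -/
def sign : Ctx → Bool
  | hole => true
  | arrowL C _ => !(sign C)
  | arrowR _ C => sign C
  | interL C _ => sign C
  | interR _ C => sign C

/-- The hole is strictly positive: it never passes through the left argument
of an `→`. -/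
def strictPos : Ctx → Prop
  | hole => True
  | arrowL _ _ => False
  | arrowR _ C => strictPos C
  | interL C _ => strictPos C
  | interR _ C => strictPos C

end Ctx

/-- The Munich system for the subtype relation. -/
inductive Munich : Ty → Ty → Prop
  | slat {A B : Ty} : Ty.Slat A B → Munich A B
  | distrib (E D : Ctx) (B C : Ty) : D.strictPos →
      Munich (E.fill (D.fill (Ty.inter B C))) (E.fill (Ty.inter (D.fill B) (D.fill C)))
  | posElim (E : Ctx) (B C : Ty) : E.sign = true →
      Munich (E.fill (Ty.inter B C)) (E.fill B)
  | negIntro (E : Ctx) (B C : Ty) : E.sign = false →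
      Munich (E.fill B) (E.fill (Ty.inter B C))
  | trans {A B C : Ty} : Munich A B → Munich B C → Munich A C

/-- BCD derivations (as proof trees). A basis is a finite list of types, the
variable `var n` receiving the `n`-th type of the list. -/
inductive Deriv : List Ty → Term → Ty → Type
  | var (Γ : List Ty) (n : ℕ) (A : Ty) : Γ[n]? = some A → Deriv Γ (Term.var n) A
  | lam (Γ : List Ty) (t : Term) (A B : Ty) :
      Deriv (A :: Γ) t B → Deriv Γ (Term.lam t) (Ty.arrow A B)
  | app (Γ : List Ty) (s t : Term) (A B : Ty) :
      Deriv Γ s (Ty.arrow A B) → Deriv Γ t A → Deriv Γ (Term.app s t) B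
  | inter (Γ : List Ty) (t : Term) (A B : Ty) :
      Deriv Γ t A → Deriv Γ t B → Deriv Γ t (Ty.inter A B)
  | sub (Γ : List Ty) (t : Term) (A B : Ty) :
      Deriv Γ t A → Ty.Sub A B → Deriv Γ t B

/-- BCD derivability. -/
def BCD (Γ : List Ty) (t : Term) (A : Ty) : Prop := Nonempty (Deriv Γ t A)

/-- All the types of a basis are in dist normal form. -/
def CtxDnf (Γ : List Ty) : Prop := ∀ B ∈ Γ, Ty.Dnf B

namespace Deriv

/-- Every type expression occurring in the derivation is in dist normal form. -/
def allDnf : {Γ : List Ty} → {t : Term} → {A : Ty} → Deriv Γ t A → Prop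
  | _, _, _, var Γ _ A _ => CtxDnf Γ ∧ Ty.Dnf A
  | _, _, _, lam _ _ A B d => Ty.Dnf (Ty.arrow A B) ∧ allDnf d
  | _, _, _, app _ _ _ _ _ d e => allDnf d ∧ allDnf e
  | _, _, _, inter _ _ _ _ d e => allDnf d ∧ allDnf e
  | _, _, _, sub _ _ _ B d _ => Ty.Dnf B ∧ allDnf d

/-- Every application of the subtyping rule has a variable as its subject. -/
def subOnVar : {Γ : List Ty} → {t : Term} → {A : Ty} → Deriv Γ t A → Prop
  | _, _, _, var _ _ _ _ => True
  | _, _, _, lam _ _ _ _ d => subOnVar d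
  | _, _, _, app _ _ _ _ _ d e => subOnVar d ∧ subOnVar e
  | _, _, _, inter _ _ _ _ d e => subOnVar d ∧ subOnVar e
  | _, _, _, sub _ t _ _ d _ => (∃ n, t = Term.var n) ∧ subOnVar d

/-- `temperate d m` : the derivation contains no intemperate sequence, where `m`
applications are pending above the root of `d`: no subtyping inference may
change an argument type at a position that is subsequently consumed by an
application. -/
def temperate : {Γ : List Ty} → {t : Term} → {A : Ty} → Deriv Γ t A → ℕ → Prop
  | _, _, _, var _ _ _ _, _ => True
  | _, _, _, lam _ _ _ _ d, _ => temperate d 0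
  | _, _, _, app _ _ _ _ _ d e, m => temperate d (m + 1) ∧ temperate e 0
  | _, _, _, inter _ _ _ _ d e, _ => temperate d 0 ∧ temperate e 0
  | _, _, _, sub _ _ A B d _, m =>
      (∀ i < m, Ty.argTy A i = Ty.argTy B i) ∧ temperate d m

/-- Almost minimal derivation. -/
def AM {Γ : List Ty} {t : Term} {A : Ty} (d : Deriv Γ t A) : Prop :=
  allDnf d ∧ subOnVar d ∧ temperate d 0

/-- `avoids d k` : the variable (currently of index) `k` is not used in the
derivation `d`. -/
def avoids : {Γ : List Ty} → {t : Term} → {A : Ty} → Deriv Γ t A → ℕ → Prop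
  | _, _, _, var _ n _ _, k => n ≠ k
  | _, _, _, lam _ _ _ _ d, k => avoids d (k + 1)
  | _, _, _, app _ _ _ _ _ d e, k => avoids d k ∧ avoids e k
  | _, _, _, inter _ _ _ _ d e, k => avoids d k ∧ avoids e k
  | _, _, _, sub _ _ _ _ d _, k => avoids d k

end Deriv

def Kterm : Term := Term.lam (Term.lam (Term.var 1))
def KstarTerm : Term := Term.lam (Term.lam (Term.var 0))

def applyList : Term → List Term → Term
  | M, [] => M
  | M, a :: l => applyList (Term.app M a) l

/-- Solvability of a closed term. -/
def Solvable (M : Term) : Prop :=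
  ∃ args : List Term, Term.Conv (applyList M args) (Term.lam (Term.var 0))

/-- A numeral system: a sequence of closed terms together with a successor `S`
and a zero test `Z`. -/
def NumeralSystem (d : ℕ → Term) : Prop :=
  (∀ n, Term.Closed (d n)) ∧
  ∃ S Z : Term, Term.Closed S ∧ Term.Closed Z ∧
    (∀ n, Term.Conv (Term.app S (d n)) (d (n + 1))) ∧
    Term.Conv (Term.app Z (d 0)) KstarTerm ∧
    (∀ n, 0 < n → Term.Conv (Term.app Z (d n)) Kterm)

/-- Lambda definability of a partial function on a numeral system. -/
def LambdaDefinableOn (d : ℕ → Term) (f : ℕ →. ℕ) : Prop :=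
  ∃ F : Term, Term.Closed F ∧
    (∀ n m, m ∈ f n → Term.Conv (Term.app F (d n)) (d m)) ∧
    (∀ n, ¬ (f n).Dom → ¬ Solvable (Term.app F (d n)))

/-- Adequacy: every partial recursive function is lambda definable on the system. -/
def Adequate (d : ℕ → Term) : Prop :=
  ∀ f : ℕ →. ℕ, Nat.Partrec f → LambdaDefinableOn d f

/-- `FG i r k` builds `f(λ x_{k+1}. f( ... f(λ x_n. x_i) ...))` with `r = n - k`
remaining levels, in the context `f, x_1, ..., x_k`. -/
def FG (i : ℕ) : ℕ → ℕ → Term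
  | 0, k => Term.var (k - i)
  | r + 1, k => Term.app (Term.var k) (Term.lam (FG i r (k + 1)))

/-- `Fterm i n = λ f. f(λ x₁. f(λ x₂. ... f(λ xₙ. x_i) ...))`. -/
def Fterm (i n : ℕ) : Term := Term.lam (FG i n 0)

/-- `X'` is an eta expansion of `X`. -/
def EtaExpandsTo (X X' : Term) : Prop :=
  Relation.ReflTransGen (fun a b => Term.Eta b a) X X'

/-- New normal form (for the parameter `n`): beta normal, every lambda prefix in
the Böhm tree has length `n+1` except the newly introduced eta variables (length
`0`), and every maximal oscillation has length `n+1`. -/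
def NewNF (n : ℕ) (X : Term) : Prop :=
  Term.BetaNormal X ∧
  (∀ d w, Term.Desc X d w → Term.prefixLen w = n + 1 ∨ Term.prefixLen w = 0) ∧
  (∀ d w l, Term.Desc X d w → Term.Osc w l → Term.Osc w (l + 1) ∨ l = n + 1)

/-- Having a beta normal form. -/
def HasBetaNF (M : Term) : Prop :=
  ∃ N, Relation.ReflTransGen Term.Beta M N ∧ Term.BetaNormal N

/-- The map taking a term of `S` to the Gödel number of its beta-eta normal form
is representable. -/
def GodelRepresentable (S : Set Term) : Prop :=
  ∃ M : Term, Term.Closed M ∧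
    ∀ N ∈ S, Term.BetaEtaNormal N → Term.Conv (Term.app M N) (church (gnum N))

/-- The set `S` (closed under beta-eta conversion) forms an adequate numeral
system. -/
def IsAdequateNumeralSystem (S : Set Term) : Prop :=
  ∃ d : ℕ → Term, NumeralSystem d ∧ Adequate d ∧
    (∀ n, d n ∈ S) ∧ (∀ M ∈ S, ∃ n, Term.Conv M (d n)) ∧
    (∀ n m, Term.Conv (d n) (d m) → n = m)

namespace Term

/-! ### Renaming and parallel substitution -/

/-- Extend a renaming under a binder. -/
def upr (ξ : ℕ → ℕ) : ℕ → ℕ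
  | 0 => 0
  | i + 1 => ξ i + 1

/-- Renaming of the free variables. -/
def ren : (ℕ → ℕ) → Term → Term
  | ξ, var n => var (ξ n)
  | ξ, app s t => app (ren ξ s) (ren ξ t)
  | ξ, lam t => lam (ren (upr ξ) t)

/-- Prepend an entry to a substitution or an environment. -/
def scons {α : Type*} (u : α) (σ : ℕ → α) : ℕ → α
  | 0 => u
  | i + 1 => σ i

/-- Extend a substitution under a binder. -/
def up (σ : ℕ → Term) : ℕ → Term := scons (var 0) fun i => ren Nat.succ (σ i)

/-- Parallel substitution. -/
def sub : (ℕ → Term) → Term → Term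
  | σ, var n => σ n
  | σ, app s t => app (sub σ s) (sub σ t)
  | σ, lam t => lam (sub (up σ) t)

theorem ren_ren (t : Term) : ∀ ξ ζ : ℕ → ℕ, ren ζ (ren ξ t) = ren (fun i => ζ (ξ i)) t := by
  induction t with
  | var n => intros; rfl
  | app s t hs ht => intro ξ ζ; simp only [ren, hs, ht]
  | lam t ih =>
    intro ξ ζ
    simp only [ren, ih]
    congr 2; funext i; cases i <;> rfl

theorem sub_ren (t : Term) : ∀ (ξ : ℕ → ℕ) (σ : ℕ → Term),
    sub σ (ren ξ t) = sub (fun i => σ (ξ i)) t := by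
  induction t with
  | var n => intros; rfl
  | app s t hs ht => intro ξ ζ; simp only [ren, sub, hs, ht]
  | lam t ih =>
    intro ξ ζ
    simp only [ren, sub, ih]
    congr 2; funext i; cases i <;> rfl

theorem ren_sub (t : Term) : ∀ (σ : ℕ → Term) (ξ : ℕ → ℕ),
    ren ξ (sub σ t) = sub (fun i => ren ξ (σ i)) t := by
  induction t with
  | var n => intros; rfl
  | app s t hs ht => intro ξ ζ; simp only [ren, sub, hs, ht]
  | lam t ih =>
    intro ξ ζ
    simp only [ren, sub, ih]
    congr 2; funext i
    cases i with
    | zero => rfl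
    | succ i => simp only [up, scons, ren_ren]; rfl

theorem sub_sub (t : Term) : ∀ σ τ : ℕ → Term,
    sub τ (sub σ t) = sub (fun i => sub τ (σ i)) t := by
  induction t with
  | var n => intros; rfl
  | app s t hs ht => intro ξ ζ; simp only [sub, hs, ht]
  | lam t ih =>
    intro σ τ
    simp only [sub, ih]
    congr 2; funext i
    cases i with
    | zero => rfl
    | succ i => simp only [up, scons, ren_sub, sub_ren]

theorem ren_eq_sub (t : Term) : ∀ ξ : ℕ → ℕ, ren ξ t = sub (fun i => var (ξ i)) t := by
  induction t with
  | var n => intros; rfl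
  | app s t hs ht => intro ξ; simp only [ren, sub, hs, ht]
  | lam t ih =>
    intro ξ
    simp only [ren, sub, ih]
    congr 2; funext i; cases i <;> rfl

theorem sub_eq_self {t : Term} : ∀ {k : ℕ} {σ : ℕ → Term}, ClosedUnder k t →
    (∀ i < k, σ i = var i) → sub σ t = t := by
  induction t with
  | var n => intro k σ h hσ; exact hσ n h
  | app s t hs ht => intro k σ h hσ; simp only [sub, hs h.1 hσ, ht h.2 hσ]
  | lam t ih =>
    intro k σ h hσ
    rw [sub, ih (k := k + 1) h]
    intro i hi
    cases i with
    | zero => rfl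
    | succ i => simp [up, scons, hσ i (by omega), ren]

theorem sub_closed {t : Term} (h : Closed t) (σ : ℕ → Term) : sub σ t = t :=
  sub_eq_self h fun i hi => absurd hi (Nat.not_lt_zero i)

theorem sub_var (t : Term) : sub var t = t := by
  have h : ∀ t : Term, ∃ k, ClosedUnder k t := by
    intro t
    have mono : ∀ t : Term, ∀ {k l : ℕ}, k ≤ l → ClosedUnder k t → ClosedUnder l t := by
      intro t
      induction t with
      | var n => intro k l h h'; exact lt_of_lt_of_le h' h
      | app s t hs ht => intro k l h h'; exact ⟨hs h h'.1, ht h h'.2⟩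
      | lam t ih => intro k l h h'; exact ih (Nat.succ_le_succ h) h'
    induction t with
    | var n => exact ⟨n + 1, Nat.lt_succ_self n⟩
    | app s t hs ht =>
      obtain ⟨k, hk⟩ := hs
      obtain ⟨l, hl⟩ := ht
      exact ⟨max k l, mono _ (le_max_left _ _) hk, mono _ (le_max_right _ _) hl⟩
    | lam t ih =>
      obtain ⟨k, hk⟩ := ih
      exact ⟨k, mono t (Nat.le_succ k) hk⟩
  obtain ⟨k, hk⟩ := h t
  exact sub_eq_self hk fun _ _ => rfl

theorem lift_eq_ren (d : ℕ) (t : Term) :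
    ∀ k, lift d k t = ren (fun n => if n < k then n else n + d) t := by
  induction t with
  | var n => intro k; simp only [lift, ren]; split <;> rfl
  | app s t hs ht => intro k; simp only [lift, ren, hs, ht]
  | lam t ih =>
    intro k
    simp only [lift, ren, ih]
    congr 2; funext i
    cases i with
    | zero => simp [upr]
    | succ i => simp only [upr]; split_ifs <;> omega

theorem lift_zero_eq_ren (d : ℕ) (t : Term) : lift d 0 t = ren (fun n => n + d) t := by
  simp [lift_eq_ren]

theorem lift_lift_zero (a b : ℕ) (t : Term) : lift a 0 (lift b 0 t) = lift (b + a) 0 t := by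
  simp only [lift_zero_eq_ren, ren_ren, Nat.add_assoc]

theorem lift_zero_zero (t : Term) : lift 0 0 t = t := by
  rw [lift_zero_eq_ren, ren_eq_sub]; exact sub_var t

theorem subst_eq_sub (u t : Term) : ∀ k, subst u k t =
    sub (fun n => if n = k then lift k 0 u else if k < n then var (n - 1) else var n) t := by
  induction t with
  | var n => intro k; rfl
  | app s t hs ht => intro k; simp only [subst, sub, hs, ht]
  | lam t ih =>
    intro k
    simp only [subst, sub, ih]
    congr 2; funext i
    cases i with
    | zero => simp [up, scons]
    | succ i =>
      simp only [up, scons, Nat.add_right_cancel_iff, Nat.add_lt_add_iff_right]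
      split_ifs with h1 h2
      · simp only [lift_zero_eq_ren, ren_ren]
        rfl
      · simp only [ren]; congr 1; omega
      · rfl

theorem subst_zero_eq_sub (u t : Term) : subst u 0 t = sub (scons u var) t := by
  rw [subst_eq_sub]
  congr 1; funext i
  cases i with
  | zero => simp [scons, lift_zero_zero]
  | succ i => simp [scons]

theorem subst_sub_up (u t : Term) (σ : ℕ → Term) :
    subst u 0 (sub (up σ) t) = sub (scons u σ) t := by
  rw [subst_zero_eq_sub, sub_sub]
  congr 1; funext i
  cases i with
  | zero => rfl
  | succ i => simp only [up, scons, sub_ren]; exact sub_var _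

theorem sub_subst (u t : Term) (σ : ℕ → Term) :
    sub σ (subst u 0 t) = subst (sub σ u) 0 (sub (up σ) t) := by
  rw [subst_sub_up, subst_zero_eq_sub, sub_sub]
  congr 1; funext i; cases i <;> rfl

theorem sub_up_lift (t : Term) (σ : ℕ → Term) :
    sub (up σ) (lift 1 0 t) = lift 1 0 (sub σ t) := by
  simp only [lift_zero_eq_ren, sub_ren, ren_sub]
  rfl

theorem closedUnder_ren {t : Term} : ∀ {k l : ℕ} {ξ : ℕ → ℕ}, ClosedUnder k t →
    (∀ i < k, ξ i < l) → ClosedUnder l (ren ξ t) := by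
  induction t with
  | var n => intro k l ξ h hξ; exact hξ n h
  | app s t hs ht => intro k l ξ h hξ; exact ⟨hs h.1 hξ, ht h.2 hξ⟩
  | lam t ih =>
    intro k l ξ h hξ
    refine ih (k := k + 1) h fun i hi => ?_
    cases i with
    | zero => exact Nat.succ_pos l
    | succ i => exact Nat.succ_lt_succ (hξ i (by omega))

theorem closedUnder_sub {t : Term} : ∀ {k : ℕ} {σ : ℕ → Term},
    (∀ i, ClosedUnder k (σ i)) → ClosedUnder k (sub σ t) := by
  induction t with
  | var n => intro k σ h; exact h n
  | app s t hs ht => intro k σ h; exact ⟨hs h, ht h⟩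
  | lam t ih =>
    intro k σ h
    refine ih (k := k + 1) fun i => ?_
    cases i with
    | zero => exact Nat.succ_pos k
    | succ i => exact closedUnder_ren (h i) fun j hj => Nat.succ_lt_succ hj

/-! ### Reduction -/

/-- Beta-eta reduction. -/
abbrev Red : Term → Term → Prop := Relation.ReflTransGen BetaEta

theorem BetaEta.appL {s s' : Term} (t : Term) (h : BetaEta s s') :
    BetaEta (app s t) (app s' t) := h.imp (Beta.appL t) (Eta.appL t)

theorem BetaEta.appR (s : Term) {t t' : Term} (h : BetaEta t t') :
    BetaEta (app s t) (app s t') := h.imp (Beta.appR s) (Eta.appR s)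

theorem BetaEta.lam {t t' : Term} (h : BetaEta t t') : BetaEta (lam t) (lam t') :=
  h.imp Beta.lam Eta.lam

theorem Red.app {s s' t t' : Term} (hs : Red s s') (ht : Red t t') :
    Red (app s t) (app s' t') :=
  (hs.lift (fun x => Term.app x t) fun _ _ h => h.appL t).trans
    (ht.lift (fun x => Term.app s' x) fun _ _ h => h.appR s')

theorem Red.lam {t t' : Term} (h : Red t t') : Red (lam t) (lam t') :=
  h.lift _ fun _ _ h => h.lam

theorem Beta.sub {t t' : Term} (h : Beta t t') : ∀ σ, Beta (sub σ t) (sub σ t') := by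
  induction h with
  | beta t u => intro σ; rw [sub_subst]; exact Beta.beta _ _
  | appL t _ ih => intro σ; exact Beta.appL _ (ih σ)
  | appR s _ ih => intro σ; exact Beta.appR _ (ih σ)
  | lam _ ih => intro σ; exact Beta.lam (ih _)

theorem Eta.sub {t t' : Term} (h : Eta t t') : ∀ σ, Eta (sub σ t) (sub σ t') := by
  induction h with
  | eta t =>
    intro σ
    simp only [Term.sub, sub_up_lift]
    exact Eta.eta _
  | appL t _ ih => intro σ; exact Eta.appL _ (ih σ)
  | appR s _ ih => intro σ; exact Eta.appR _ (ih σ)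
  | lam _ ih => intro σ; exact Eta.lam (ih _)

theorem BetaEta.sub {t t' : Term} (h : BetaEta t t') (σ : ℕ → Term) :
    BetaEta (sub σ t) (sub σ t') := h.imp (fun h => h.sub σ) fun h => h.sub σ

theorem BetaEta.lift {t t' : Term} (h : BetaEta t t') (d k : ℕ) :
    BetaEta (lift d k t) (lift d k t') := by
  simp only [lift_eq_ren, ren_eq_sub]
  exact h.sub _

theorem Red.lift {t t' : Term} (h : Red t t') (d k : ℕ) :
    Red (Term.lift d k t) (Term.lift d k t') := by
  induction h with
  | refl => exact .refl
  | tail _ h ih => exact ih.tail (h.lift d k)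

theorem Red.eq_of_normal {t t' : Term} (h : Red t t') (ht : BetaEtaNormal t) : t' = t := by
  induction h using Relation.ReflTransGen.head_induction_on with
  | refl => rfl
  | head h _ _ => exact absurd h (ht _)

/-! ### Conversion -/

theorem Conv.map {f : Term → Term} (hf : ∀ s t, BetaEta s t → BetaEta (f s) (f t))
    {s t : Term} (h : Conv s t) : Conv (f s) (f t) := by
  induction h with
  | rel h => exact Conv.rel (hf _ _ h)
  | refl t => exact Conv.refl _
  | symm _ ih => exact ih.symm
  | trans _ _ ih ih' => exact ih.trans ih'

theorem Conv.app {s s' t t' : Term} (hs : Conv s s') (ht : Conv t t') :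
    Conv (app s t) (app s' t') :=
  (hs.map (f := fun x => Term.app x t) fun _ _ h => h.appL t).trans
    (ht.map (f := fun x => Term.app s' x) fun _ _ h => h.appR s')

theorem Conv.lam {t t' : Term} (h : Conv t t') : Conv (lam t) (lam t') :=
  h.map fun _ _ h => h.lam

theorem Conv.sub {t t' : Term} (h : Conv t t') (σ : ℕ → Term) : Conv (sub σ t) (sub σ t') :=
  h.map fun _ _ h => h.sub σ

theorem Conv.sub_congr (t : Term) : ∀ {σ τ : ℕ → Term}, (∀ i, Conv (σ i) (τ i)) →
    Conv (Term.sub σ t) (Term.sub τ t) := by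
  induction t with
  | var n => intro σ τ h; exact h n
  | app s t hs ht => intro σ τ h; exact (hs h).app (ht h)
  | lam t ih =>
    intro σ τ h
    refine (ih fun i => ?_).lam
    cases i with
    | zero => exact Conv.refl _
    | succ i =>
      simp only [up, scons, ren_eq_sub]
      exact (h i).sub _

theorem Conv.beta (t u : Term) : Conv (Term.app (Term.lam t) u) (subst u 0 t) :=
  Conv.rel (Or.inl (Beta.beta t u))

theorem Red.conv {t t' : Term} (h : Red t t') : Conv t t' := by
  induction h with
  | refl => exact Conv.refl _
  | tail _ h ih => exact ih.trans (Conv.rel h)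

/-! ### Reductions of weakened terms -/

theorem lift_one_injective {t : Term} : ∀ {k : ℕ} {u : Term}, lift 1 k t = lift 1 k u → t = u := by
  induction t with
  | var n =>
    intro k u h
    cases u with
    | var m =>
      simp only [lift] at h
      split_ifs at h <;> simp only [var.injEq] at h <;> congr 1 <;> omega
    | app => simp only [lift] at h; split at h <;> simp at h
    | lam => simp only [lift] at h; split at h <;> simp at h
  | app s t hs ht =>
    intro k u h
    cases u with
    | var m => simp only [lift] at h; split at h <;> simp at h
    | app => simp only [lift, app.injEq] at h; rw [hs h.1, ht h.2]
    | lam => simp [lift] at h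
  | lam t ih =>
    intro k u h
    cases u with
    | var m => simp only [lift] at h; split at h <;> simp at h
    | app => simp [lift] at h
    | lam => simp only [lift, lam.injEq] at h; rw [ih h]

theorem exists_of_lift_eq_lift {y : Term} : ∀ {k j : ℕ} {x : Term},
    lift 1 (k + 1 + j) y = lift 1 j x → ∃ z, y = lift 1 j z ∧ x = lift 1 (k + j) z := by
  induction y with
  | var n =>
    intro k j x h
    cases x with
    | var m =>
      refine ⟨var (if n < j then n else n - 1), ?_⟩
      have e : ∀ k n, lift 1 k (var n) = var (if n < k then n else n + 1) := by
        intro k n; simp only [lift]; split <;> rfl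
      simp only [e, var.injEq] at h ⊢
      grind
    | app => simp only [lift] at h; split at h <;> simp at h
    | lam => simp only [lift] at h; split at h <;> simp at h
  | app s t hs ht =>
    intro k j x h
    cases x with
    | var m => simp only [lift] at h; split at h <;> simp at h
    | app =>
      simp only [lift, app.injEq] at h
      obtain ⟨z, rfl, rfl⟩ := hs h.1
      obtain ⟨z', rfl, rfl⟩ := ht h.2
      exact ⟨app z z', rfl, rfl⟩
    | lam => simp [lift] at h
  | lam t ih =>
    intro k j x h
    cases x with
    | var m => simp only [lift] at h; split at h <;> simp at h
    | app => simp [lift] at h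
    | lam =>
      simp only [lift, lam.injEq] at h
      obtain ⟨z, rfl, rfl⟩ := ih (j := j + 1) h
      exact ⟨lam z, rfl, rfl⟩

theorem lift_one_subst (u t : Term) (k : ℕ) :
    lift 1 k (subst u 0 t) = subst (lift 1 k u) 0 (lift 1 (k + 1) t) := by
  simp only [lift_eq_ren, subst_zero_eq_sub, ren_sub, sub_ren]
  congr 1; funext i
  cases i with
  | zero => simp [scons]
  | succ i =>
    simp only [scons, ren, Nat.add_lt_add_iff_right]
    split_ifs <;> simp

theorem Beta.of_lift {t : Term} : ∀ {k : ℕ} {s : Term}, Beta (lift 1 k t) s →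
    ∃ t', s = lift 1 k t' ∧ Beta t t' := by
  induction t with
  | var n => intro k s h; simp only [lift] at h; split at h <;> cases h
  | app a b ha hb =>
    intro k s h
    simp only [lift] at h
    generalize hx : lift 1 k a = x at h
    cases h with
    | beta c _ =>
      cases a with
      | var => simp only [lift] at hx; split at hx <;> simp at hx
      | app => simp [lift] at hx
      | lam a =>
        simp only [lift, lam.injEq] at hx
        subst hx
        exact ⟨_, (lift_one_subst b a k).symm, Beta.beta _ _⟩
    | appL _ h =>
      subst hx
      obtain ⟨t', rfl, h'⟩ := ha h
      exact ⟨Term.app t' b, rfl, Beta.appL _ h'⟩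
    | appR _ h =>
      subst hx
      obtain ⟨t', rfl, h'⟩ := hb h
      exact ⟨Term.app a t', rfl, Beta.appR _ h'⟩
  | lam t ih =>
    intro k s h
    simp only [lift] at h
    cases h with
    | lam h =>
      obtain ⟨t', rfl, h'⟩ := ih h
      exact ⟨Term.lam t', rfl, Beta.lam h'⟩

theorem Eta.of_lift {t : Term} : ∀ {k : ℕ} {s : Term}, Eta (lift 1 k t) s →
    ∃ t', s = lift 1 k t' ∧ Eta t t' := by
  induction t with
  | var n => intro k s h; simp only [lift] at h; split at h <;> cases h
  | app a b ha hb =>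
    intro k s h
    simp only [lift] at h
    cases h with
    | appL _ h =>
      obtain ⟨t', rfl, h'⟩ := ha h
      exact ⟨Term.app t' b, rfl, Eta.appL _ h'⟩
    | appR _ h =>
      obtain ⟨t', rfl, h'⟩ := hb h
      exact ⟨Term.app a t', rfl, Eta.appR _ h'⟩
  | lam t ih =>
    intro k s h
    simp only [lift] at h
    generalize hx : lift 1 (k + 1) t = x at h
    cases h with
    | eta c =>
      cases t with
      | var => simp only [lift] at hx; split at hx <;> simp at hx
      | lam => simp [lift] at hx
      | app a b =>
        simp only [lift, app.injEq] at hx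
        obtain ⟨z, rfl, rfl⟩ := exists_of_lift_eq_lift (k := k) (j := 0) hx.1
        have hb : b = var 0 :=
          lift_one_injective (k := k + 1) (by rw [hx.2]; simp [lift])
        subst hb
        exact ⟨z, rfl, Eta.eta z⟩
    | lam h =>
      subst hx
      obtain ⟨t', rfl, h'⟩ := ih h
      exact ⟨Term.lam t', rfl, Eta.lam h'⟩

theorem BetaEta.of_lift {t s : Term} {k : ℕ} (h : BetaEta (Term.lift 1 k t) s) :
    ∃ t', s = Term.lift 1 k t' ∧ BetaEta t t' := by
  rcases h with h | h
  · obtain ⟨t', h1, h2⟩ := h.of_lift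
    exact ⟨t', h1, Or.inl h2⟩
  · obtain ⟨t', h1, h2⟩ := h.of_lift
    exact ⟨t', h1, Or.inr h2⟩

/-! ### Eta-contracting abstraction -/

/-- Partial inverse of `lift 1 k`: `none` if the variable `k` occurs free. -/
def lower : ℕ → Term → Option Term
  | k, var n => if n < k then some (var n) else if n = k then none else some (var (n - 1))
  | k, app s t => (lower k s).bind fun s' => (lower k t).map (app s')
  | k, lam t => (lower (k + 1) t).map lam

theorem lower_lift (t : Term) : ∀ k, lower k (lift 1 k t) = some t := by
  induction t with
  | var n =>
    intro k
    simp only [lift]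
    split_ifs with h
    · simp [lower, h]
    · simp only [lower]
      rw [if_neg (by omega), if_neg (by omega)]
      rfl
  | app s t hs ht => intro k; simp [lift, lower, hs, ht]
  | lam t ih => intro k; simp [lift, lower, ih]

theorem eq_lift_of_lower {t : Term} : ∀ {k : ℕ} {t' : Term}, lower k t = some t' →
    t = lift 1 k t' := by
  induction t with
  | var n =>
    intro k t' h
    simp only [lower] at h
    split_ifs at h with h1 h2
    · obtain rfl := Option.some.inj h
      simp [lift, h1]
    · obtain rfl := Option.some.inj h
      simp only [lift]
      rw [if_neg (by omega)]
      congr 1; omega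
  | app s t hs ht =>
    intro k t' h
    simp only [lower, Option.bind_eq_some_iff, Option.map_eq_some_iff] at h
    obtain ⟨a, ha, b, hb, rfl⟩ := h
    rw [hs ha, ht hb]; rfl
  | lam t ih =>
    intro k t' h
    simp only [lower, Option.map_eq_some_iff] at h
    obtain ⟨a, ha, rfl⟩ := h
    rw [ih ha]; rfl

/-- Abstraction of the variable `0`, eta-contracted when possible. -/
def etaAbs : Term → Term
  | app f (var 0) => (lower 0 f).getD (lam (app f (var 0)))
  | t => lam t

theorem etaAbs_app_lift (t : Term) : etaAbs (app (lift 1 0 t) (var 0)) = t := by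
  simp [etaAbs, lower_lift]

theorem red_lam_etaAbs (t : Term) : Red (lam t) (etaAbs t) := by
  unfold etaAbs
  split
  · rename_i f
    cases h : lower 0 f with
    | none => exact Relation.ReflTransGen.refl
    | some f' =>
      rw [eq_lift_of_lower h]
      exact Relation.ReflTransGen.single (Or.inr (Eta.eta f'))
  · exact Relation.ReflTransGen.refl

theorem subst_var_zero_lift (t : Term) : subst (var 0) 0 (lift 1 1 t) = t := by
  rw [subst_zero_eq_sub, lift_eq_ren, sub_ren]
  refine Eq.trans ?_ (sub_var t)
  congr 1; funext i
  cases i <;> simp [scons]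

theorem Red.etaAbs_of_app_var {t u : Term} (h : Red (Term.app (Term.lift 1 0 t) (var 0)) u) :
    Red t (etaAbs u) := by
  generalize hw : Term.app (Term.lift 1 0 t) (var 0) = w at h
  induction h using Relation.ReflTransGen.head_induction_on generalizing t with
  | refl => rw [← hw, etaAbs_app_lift]
  | head h h' ih =>
    subst hw
    have appL : ∀ {s'}, BetaEta (Term.lift 1 0 t) s' →
        (∀ {t'}, Term.app (Term.lift 1 0 t') (var 0) = Term.app s' (var 0) → Red t' (etaAbs u)) →
        Red t (etaAbs u) := by
      intro s' hs ih
      obtain ⟨t', rfl, ht⟩ := hs.of_lift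
      exact Relation.ReflTransGen.head ht (ih rfl)
    rcases h with h | h
    · generalize hx : Term.lift 1 0 t = x at h
      cases h with
      | beta b _ =>
        cases t with
        | var => simp [Term.lift] at hx
        | app => simp [Term.lift] at hx
        | lam t =>
          simp only [Term.lift, Term.lam.injEq] at hx
          subst hx
          rw [Nat.zero_add, subst_var_zero_lift] at h'
          exact (Red.lam h').trans (red_lam_etaAbs u)
      | appL _ h => subst hx; exact appL (Or.inl h) ih
      | appR _ h => cases h
    · cases h with
      | appL _ h => exact appL (Or.inr h) ih
      | appR _ h => cases h

/-! ### The combinatory algebra of closed terms modulo conversion -/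

/-- Conversion of closed terms. -/
def convSetoid : Setoid {t : Term // Closed t} where
  r s t := Conv s.1 t.1
  iseqv := ⟨fun t => Conv.refl t.1, Conv.symm, Conv.trans⟩

/-- Closed terms modulo conversion. -/
def CA : Type := Quotient convSetoid

namespace CA

/-- The class of a closed term. -/
def mk (t : Term) (h : Closed t) : CA := Quotient.mk convSetoid ⟨t, h⟩

theorem mk_eq_mk {s t : Term} {hs : Closed s} {ht : Closed t} :
    mk s hs = mk t ht ↔ Conv s t := Quotient.eq (r := convSetoid)

theorem exists_mk (x : CA) : ∃ t h, x = mk t h := by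
  obtain ⟨⟨t, h⟩, rfl⟩ := Quotient.exists_rep x
  exact ⟨t, h, rfl⟩

/-- A closed representative. -/
noncomputable def rep (x : CA) : Term := (Quotient.out x).1

theorem rep_closed (x : CA) : Closed x.rep := (Quotient.out x).2

theorem mk_rep (x : CA) : mk x.rep x.rep_closed = x := Quotient.out_eq x

/-- Application. -/
def ap : CA → CA → CA :=
  Quotient.map₂ (fun s t => ⟨Term.app s.1 t.1, s.2, t.2⟩) fun _ _ h _ _ h' => Conv.app h h'

infixl:70 "⬝" => ap

/-- The value of a term in an environment. -/
noncomputable def ev (ρ : ℕ → CA) (t : Term) : CA :=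
  mk (sub (fun i => (ρ i).rep) t) (closedUnder_sub fun i => (ρ i).rep_closed)

theorem ev_eq_of_conv {s t : Term} (h : Conv s t) (ρ : ℕ → CA) : ev ρ s = ev ρ t :=
  mk_eq_mk.2 (h.sub _)

theorem ev_closed {t : Term} (h : Closed t) (ρ : ℕ → CA) : ev ρ t = mk t h := by
  simp only [ev, sub_closed h]

@[simp] theorem ev_var (ρ : ℕ → CA) (i : ℕ) : ev ρ (var i) = ρ i := mk_rep _

@[simp] theorem ev_app (ρ : ℕ → CA) (s t : Term) : ev ρ (app s t) = ev ρ s ⬝ ev ρ t := rfl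

@[simp] theorem ev_lam_ap (ρ : ℕ → CA) (t : Term) (x : CA) :
    ev ρ (lam t) ⬝ x = ev (scons x ρ) t := by
  conv_lhs => rw [← mk_rep x]
  refine mk_eq_mk.2 ((Conv.beta _ _).trans ?_)
  rw [subst_sub_up]
  refine Conv.sub_congr t fun i => ?_
  cases i <;> exact Conv.refl _

theorem ev_sub (ρ : ℕ → CA) (σ : ℕ → Term) (t : Term) :
    ev ρ (sub σ t) = ev (fun i => ev ρ (σ i)) t := by
  refine mk_eq_mk.2 ?_
  rw [sub_sub]
  refine Conv.sub_congr t fun i => ?_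
  exact (mk_eq_mk (hs := closedUnder_sub fun i => (ρ i).rep_closed)
    (ht := rep_closed _)).1 (mk_rep (ev ρ (σ i))).symm

theorem ev_lift (ρ : ℕ → CA) (d : ℕ) (t : Term) :
    ev ρ (lift d 0 t) = ev (fun i => ρ (i + d)) t := by
  rw [lift_zero_eq_ren, ren_eq_sub, ev_sub]
  simp only [ev_var]

theorem ev_subst (ρ : ℕ → CA) (u t : Term) :
    ev ρ (subst u 0 t) = ev (scons (ev ρ u) ρ) t := by
  rw [subst_zero_eq_sub, ev_sub]
  congr 1; funext i
  cases i with
  | zero => rfl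
  | succ i => exact ev_var _ _

@[simp] theorem scons_zero {α : Type*} (x : α) (ρ : ℕ → α) : scons x ρ 0 = x := rfl

@[simp] theorem scons_succ {α : Type*} (x : α) (ρ : ℕ → α) (i : ℕ) :
    scons x ρ (i + 1) = ρ i := rfl

/-- The identity combinator. -/
noncomputable def I : CA := ev (fun _ => mk (lam (var 0)) Nat.one_pos) (lam (var 0))

/-- The constant environment. -/
noncomputable def triv : ℕ → CA := fun _ => I

/-- The first projection combinator. -/
noncomputable def K : CA := ev triv (lam (lam (var 1)))

/-- The second projection combinator. -/
noncomputable def K' : CA := ev triv (lam (lam (var 0)))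

/-- The pairing combinator. -/
noncomputable def pair : CA := ev triv (lam (lam (lam (app (app (var 0) (var 2)) (var 1)))))

@[simp] theorem I_ap (x : CA) : I ⬝ x = x := by simp [I]

@[simp] theorem K_ap (x y : CA) : K ⬝ x ⬝ y = x := by simp [K]

@[simp] theorem K'_ap (x y : CA) : K' ⬝ x ⬝ y = y := by simp [K']

@[simp] theorem pair_ap (x y z : CA) : pair ⬝ x ⬝ y ⬝ z = z ⬝ x ⬝ y := by simp [pair]

theorem exists_fixpoint (F : CA) : ∃ X, F ⬝ X = X := by
  obtain ⟨W, hW⟩ : ∃ W, ∀ x, W ⬝ x = F ⬝ (x ⬝ x) :=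
    ⟨ev (scons F triv) (lam (app (var 1) (app (var 0) (var 0)))), fun x => by simp⟩
  exact ⟨W ⬝ W, (hW W).symm⟩

/-! ### Numerals -/

theorem closedUnder_iterApp {k : ℕ} {f x : Term} (hf : ClosedUnder k f) (hx : ClosedUnder k x)
    (n : ℕ) : ClosedUnder k (iterApp f n x) := by
  induction n with
  | zero => exact hx
  | succ n ih => exact ⟨hf, ih⟩

theorem sub_iterApp (σ : ℕ → Term) (f x : Term) (n : ℕ) :
    sub σ (iterApp f n x) = iterApp (sub σ f) n (sub σ x) := by
  induction n with
  | zero => rfl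
  | succ n ih => simp only [iterApp, sub, ih]

theorem closed_church (n : ℕ) : Closed (church n) :=
  closedUnder_iterApp (k := 2) (f := var 1) (x := var 0) Nat.one_lt_two Nat.two_pos n

/-- The class of a Church numeral. -/
def num (n : ℕ) : CA := mk (church n) (closed_church n)

theorem ev_church (ρ : ℕ → CA) (n : ℕ) : ev ρ (church n) = num n := ev_closed (closed_church n) ρ

theorem num_ap (n : ℕ) (f x : CA) : num n ⬝ f ⬝ x = (fun y => f ⬝ y)^[n] x := by
  rw [← ev_church triv, church, ev_lam_ap, ev_lam_ap]
  induction n with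
  | zero => exact ev_var _ _
  | succ n ih =>
    simp only [iterApp, ev_app, ih, Function.iterate_succ_apply', ev_var, scons_zero, scons_succ]

@[simp] theorem num_zero_ap (f x : CA) : num 0 ⬝ f ⬝ x = x := num_ap 0 f x

theorem num_succ_ap (n : ℕ) (f x : CA) : num (n + 1) ⬝ f ⬝ x = f ⬝ (num n ⬝ f ⬝ x) := by
  simp only [num_ap, Function.iterate_succ_apply']

/-- The successor combinator. -/
noncomputable def succ : CA :=
  ev triv (lam (lam (lam (app (var 1) (app (app (var 2) (var 1)) (var 0))))))

@[simp] theorem succ_ap (n : ℕ) : succ ⬝ num n = num (n + 1) := by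
  rw [succ, ev_lam_ap, ← ev_church triv, ← ev_subst, ← ev_church triv]
  refine ev_eq_of_conv ?_ _
  rw [subst_zero_eq_sub]
  refine (((Conv.refl _).app ?_).lam.lam : Conv (lam (lam (app (var 1) _)))
    (lam (lam (app (var 1) _))))
  have h : up (up (scons (church n) var)) 2 = church n := by
    simp only [up, scons, ren_eq_sub, sub_closed (closed_church n)]
  simp only [sub, h]
  refine ((Conv.beta _ _).app (Conv.refl _)).trans ?_
  rw [subst_zero_eq_sub]
  refine (Conv.beta _ _).trans ?_
  rw [subst_zero_eq_sub, sub_iterApp, sub_iterApp]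
  exact Conv.refl _

/-! ### Definability of primitive recursive functions -/

/-- Encoding of lists of numbers. -/
noncomputable def enc : List ℕ → CA
  | [] => I
  | a :: l => pair ⬝ num a ⬝ enc l

@[simp] theorem enc_cons_K (a : ℕ) (l : List ℕ) : enc (a :: l) ⬝ K = num a := by simp [enc]

@[simp] theorem enc_cons_K' (a : ℕ) (l : List ℕ) : enc (a :: l) ⬝ K' = enc l := by simp [enc]

/-- `F` computes the numerical function `f` on encoded vectors. -/
def Computes {n : ℕ} (F : CA) (f : List.Vector ℕ n → ℕ) : Prop :=
  ∀ v : List.Vector ℕ n, F ⬝ enc v.toList = num (f v)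

theorem exists_enc_ofFn {m : ℕ} : ∀ {n : ℕ} {g : Fin n → List.Vector ℕ m → ℕ},
    (∀ i, ∃ F, Computes F (g i)) →
    ∃ G, ∀ v : List.Vector ℕ m, G ⬝ enc v.toList = enc (List.Vector.ofFn fun i => g i v).toList
  | 0, g, _ => ⟨K ⬝ I, fun v => by simp [enc, List.Vector.ofFn]⟩
  | n + 1, g, h => by
    obtain ⟨F, hF⟩ := h 0
    obtain ⟨G, hG⟩ := exists_enc_ofFn fun i : Fin n => h i.succ
    refine ⟨ev (scons pair (scons F (scons G triv)))
      (lam (app (app (var 1) (app (var 2) (var 0))) (app (var 3) (var 0)))), fun v => ?_⟩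
    simp [hF v, hG v, List.Vector.ofFn, enc]

theorem exists_computes {n : ℕ} {f : List.Vector ℕ n → ℕ} (hf : Nat.Primrec' f) :
    ∃ F, Computes F f := by
  induction hf with
  | zero => exact ⟨K ⬝ num 0, fun v => by simp⟩
  | succ =>
    refine ⟨ev (scons succ (scons K triv)) (lam (app (var 1) (app (var 0) (var 2)))), fun v => ?_⟩
    obtain ⟨a, w, rfl⟩ := v.exists_eq_cons
    simp
  | @get n i =>
    induction n with
    | zero => exact i.elim0
    | succ n ih =>
      refine Fin.cases ?_ (fun i => ?_) i
      · refine ⟨ev (scons K triv) (lam (app (var 0) (var 1))), fun v => ?_⟩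
        obtain ⟨a, w, rfl⟩ := v.exists_eq_cons
        simp
      · obtain ⟨F, hF⟩ := ih i
        refine ⟨ev (scons F (scons K' triv)) (lam (app (var 1) (app (var 0) (var 2)))),
          fun v => ?_⟩
        obtain ⟨a, w, rfl⟩ := v.exists_eq_cons
        simp [hF w]
  | @comp m n f g hf hg ihf ihg =>
    obtain ⟨F, hF⟩ := ihf
    obtain ⟨G, hG⟩ := exists_enc_ofFn ihg
    refine ⟨ev (scons F (scons G triv)) (lam (app (var 1) (app (var 2) (var 0)))), fun v => ?_⟩
    rw [← hF]
    simp [hG]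
  | @prec n f g hf hg ihf ihg =>
    obtain ⟨F, hF⟩ := ihf
    obtain ⟨G, hG⟩ := ihg
    obtain ⟨S, hS⟩ : ∃ S, ∀ t p, S ⬝ t ⬝ p =
        pair ⬝ (succ ⬝ (p ⬝ K)) ⬝ (G ⬝ (pair ⬝ (p ⬝ K) ⬝ (pair ⬝ (p ⬝ K') ⬝ t))) :=
      ⟨ev (scons pair (scons succ (scons G (scons K (scons K' triv)))))
        (lam (lam (app (app (var 2) (app (var 3) (app (var 0) (var 5))))
          (app (var 4) (app (app (var 2) (app (var 0) (var 5)))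
            (app (app (var 2) (app (var 0) (var 6))) (var 1))))))), fun t p => by simp⟩
    have key : ∀ (w : List.Vector ℕ n) (k : ℕ),
        num k ⬝ (S ⬝ enc w.toList) ⬝ (pair ⬝ num 0 ⬝ (F ⬝ enc w.toList)) =
        pair ⬝ num k ⬝ num (k.rec (f w) fun y IH => g (y ::ᵥ IH ::ᵥ w)) := by
      intro w k
      induction k with
      | zero => simp [hF w]
      | succ k ih =>
        rw [num_succ_ap, ih, hS]
        simp only [pair_ap, K_ap, K'_ap, succ_ap]
        congr 1
        exact hG (k ::ᵥ _ ::ᵥ w)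
    refine ⟨ev (scons pair (scons (num 0) (scons F (scons S (scons K (scons K' triv))))))
      (lam (app (app (app (app (var 0) (var 5)) (app (var 4) (app (var 0) (var 6))))
        (app (app (var 1) (var 2)) (app (var 3) (app (var 0) (var 6))))) (var 6))), fun v => ?_⟩
    obtain ⟨a, w, rfl⟩ := v.exists_eq_cons
    simp [key]

theorem exists_num_of_primrec {f : ℕ → ℕ} (hf : Primrec f) :
    ∃ F, ∀ n, F ⬝ num n = num (f n) := by
  obtain ⟨F, hF⟩ := exists_computes (Nat.Primrec'.prim_iff₁.2 hf)
  refine ⟨ev (scons F (scons pair (scons I triv)))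
    (lam (app (var 1) (app (app (var 2) (var 0)) (var 3)))), fun n => ?_⟩
  simpa [enc] using hF (n ::ᵥ List.Vector.nil)

theorem exists_num_of_primrec₂ {f : ℕ → ℕ → ℕ} (hf : Primrec₂ f) :
    ∃ F, ∀ m n, F ⬝ num m ⬝ num n = num (f m n) := by
  obtain ⟨F, hF⟩ := exists_computes (Nat.Primrec'.prim_iff₂.2 hf)
  refine ⟨ev (scons F (scons pair (scons I triv)))
    (lam (lam (app (var 2) (app (app (var 3) (var 1)) (app (app (var 3) (var 0)) (var 4)))))),
    fun m n => ?_⟩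
  simpa [enc] using hF (m ::ᵥ n ::ᵥ List.Vector.nil)

/-- Definition by cases on `0`, `1` and larger numbers. -/
theorem exists_case : ∃ C, ∀ x y z, C ⬝ num 0 ⬝ x ⬝ y ⬝ z = x ∧ C ⬝ num 1 ⬝ x ⬝ y ⬝ z = y ∧
    ∀ n, C ⬝ num (n + 2) ⬝ x ⬝ y ⬝ z = z := by
  refine ⟨ev triv (lam (app (app (var 0)
    (lam (lam (lam (lam (app (app (app (var 3) (var 1)) (var 0)) (var 0)))))))
    (lam (lam (lam (var 2)))))), fun x y z => ⟨?_, ?_, fun n => ?_⟩⟩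
  · simp
  · simp [num_succ_ap]
  · simp only [ev_lam_ap, ev_app, ev_var, scons_zero, num_succ_ap, scons_succ]
    generalize num (n + 2) = w
    induction n with
    | zero => simp
    | succ n ih => rw [num_succ_ap]; simpa using ih

/-! ### Computing with codes of terms -/

/-- The result of `lower` as a number. -/
def lowerCode (k : ℕ) (t : Term) : ℕ := ((lower k t).map fun t' => gnum t' + 1).getD 0

/-- The code of a weakened variable. -/
def lowerVar (k n : ℕ) : ℕ :=
  if n < k then Nat.pair 0 n + 1 else if n = k then 0 else Nat.pair 0 (n - 1) + 1

/-- The code of a weakened application. -/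
def lowerApp (a b : ℕ) : ℕ :=
  if a = 0 then 0 else if b = 0 then 0 else Nat.pair 1 (Nat.pair (a - 1) (b - 1)) + 1

/-- The code of a weakened abstraction. -/
def lowerLam (a : ℕ) : ℕ := if a = 0 then 0 else Nat.pair 2 (a - 1) + 1

theorem primrec₂_lowerVar : Primrec₂ lowerVar :=
  Primrec.ite (Primrec.nat_lt.comp Primrec.snd Primrec.fst)
    (Primrec.succ.comp (Primrec₂.natPair.comp (Primrec.const 0) Primrec.snd))
    (Primrec.ite (Primrec.eq.comp Primrec.snd Primrec.fst) (Primrec.const 0)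
      (Primrec.succ.comp (Primrec₂.natPair.comp (Primrec.const 0)
        (Primrec.pred.comp Primrec.snd))))

theorem primrec₂_lowerApp : Primrec₂ lowerApp :=
  Primrec.ite (Primrec.eq.comp Primrec.fst (Primrec.const 0)) (Primrec.const 0)
    (Primrec.ite (Primrec.eq.comp Primrec.snd (Primrec.const 0)) (Primrec.const 0)
      (Primrec.succ.comp (Primrec₂.natPair.comp (Primrec.const 1)
        (Primrec₂.natPair.comp (Primrec.pred.comp Primrec.fst) (Primrec.pred.comp Primrec.snd)))))

theorem primrec_lowerLam : Primrec lowerLam :=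
  Primrec.ite (Primrec.eq.comp Primrec.id (Primrec.const 0)) (Primrec.const 0)
    (Primrec.succ.comp (Primrec₂.natPair.comp (Primrec.const 2) Primrec.pred))

theorem primrec_unpair_fst : Primrec fun n : ℕ => n.unpair.1 := Primrec.fst.comp Primrec.unpair

theorem primrec_unpair_snd : Primrec fun n : ℕ => n.unpair.2 := Primrec.snd.comp Primrec.unpair

theorem exists_lower : ∃ F, ∀ k t, F ⬝ num k ⬝ num (gnum t) = num (lowerCode k t) := by
  obtain ⟨C, hC⟩ := exists_case
  obtain ⟨T, hT⟩ := exists_num_of_primrec primrec_unpair_fst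
  obtain ⟨B, hB⟩ := exists_num_of_primrec primrec_unpair_snd
  obtain ⟨V, hV⟩ := exists_num_of_primrec₂ primrec₂_lowerVar
  obtain ⟨P, hP⟩ := exists_num_of_primrec₂ primrec₂_lowerApp
  obtain ⟨L, hL⟩ := exists_num_of_primrec primrec_lowerLam
  obtain ⟨G, hG⟩ : ∃ G, ∀ f k c, G ⬝ f ⬝ k ⬝ c = C ⬝ (T ⬝ c) ⬝ (V ⬝ k ⬝ (B ⬝ c)) ⬝
      (P ⬝ (f ⬝ k ⬝ (T ⬝ (B ⬝ c))) ⬝ (f ⬝ k ⬝ (B ⬝ (B ⬝ c)))) ⬝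
      (L ⬝ (f ⬝ (succ ⬝ k) ⬝ (B ⬝ c))) :=
    ⟨ev (scons C (scons T (scons V (scons B (scons P (scons L (scons succ triv)))))))
      (lam (lam (lam (app (app (app (app (var 3) (app (var 4) (var 0)))
        (app (app (var 5) (var 1)) (app (var 6) (var 0))))
        (app (app (var 7) (app (app (var 2) (var 1)) (app (var 4) (app (var 6) (var 0)))))
          (app (app (var 2) (var 1)) (app (var 6) (app (var 6) (var 0))))))
        (app (var 8) (app (app (var 2) (app (var 9) (var 1))) (app (var 6) (var 0)))))))),
      fun f k c => by simp⟩
  obtain ⟨F, hF⟩ := exists_fixpoint G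
  refine ⟨F, fun k t => ?_⟩
  induction t generalizing k with
  | var n =>
    rw [← hF, hG]
    simp only [gnum, hT, hB, Nat.unpair_pair, (hC _ _ _).1, hV]
    congr 1
    simp only [lowerCode, lower, lowerVar]
    split_ifs <;> rfl
  | app s t hs ht =>
    rw [← hF, hG]
    simp only [gnum, hT, hB, Nat.unpair_pair, (hC _ _ _).2.1, hs, ht, hP]
    congr 1
    simp only [lowerCode, lower, lowerApp]
    rcases (lower k s).eq_none_or_eq_some with h | ⟨x, h⟩ <;>
      rcases (lower k t).eq_none_or_eq_some with h' | ⟨y, h'⟩ <;> simp [h, h', gnum]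
  | lam t ih =>
    rw [← hF, hG]
    simp only [gnum, hT, hB, Nat.unpair_pair, (hC _ _ _).2.2 0, ih, succ_ap, hL]
    congr 1
    simp only [lowerCode, lower, lowerLam]
    rcases (lower (k + 1) t).eq_none_or_eq_some with h | ⟨x, h⟩ <;> simp [h, gnum]

/-- Recognizes the codes of the terms `app f (var 0)`. -/
def isEtaCode (c : ℕ) : ℕ :=
  if (c - 2).unpair.1 = 1 then
    if (c - 2).unpair.2.unpair.2 = Nat.pair 0 0 then 1 else 0
  else 0

/-- The code of the eta-contracted abstraction, given the result of lowering. -/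
def etaCode (r c : ℕ) : ℕ := if r = 0 then Nat.pair 2 (c - 2) + 2 else r + 1

theorem primrec_isEtaCode : Primrec isEtaCode := by
  have h : Primrec fun c : ℕ => c - 2 := Primrec.nat_sub.comp Primrec.id (Primrec.const 2)
  have h2 := primrec_unpair_snd.comp h
  exact Primrec.ite (Primrec.eq.comp (primrec_unpair_fst.comp h) (Primrec.const 1))
    (Primrec.ite (Primrec.eq.comp (primrec_unpair_snd.comp h2) (Primrec.const _))
      (Primrec.const 1) (Primrec.const 0)) (Primrec.const 0)

theorem primrec₂_etaCode : Primrec₂ etaCode :=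
  Primrec.ite (Primrec.eq.comp Primrec.fst (Primrec.const 0))
    (Primrec.nat_add.comp (Primrec₂.natPair.comp (Primrec.const 2)
      (Primrec.nat_sub.comp Primrec.snd (Primrec.const 2))) (Primrec.const 2))
    (Primrec.succ.comp Primrec.fst)

theorem gnum_injective : Function.Injective gnum := by
  intro s
  induction s with
  | var n => intro t h; cases t <;> simp_all [gnum, Nat.pair_eq_pair]
  | app a b ha hb =>
    intro t h
    cases t <;> simp only [gnum, Nat.pair_eq_pair] at h
    · omega
    · rw [ha h.2.1, hb h.2.2]
    · omega
  | lam a ha =>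
    intro t h
    cases t <;> simp only [gnum, Nat.pair_eq_pair] at h
    · omega
    · omega
    · rw [ha h.2]

theorem isEtaCode_app (f : Term) : isEtaCode (gnum (app f (var 0)) + 2) = 1 := by
  simp [isEtaCode, gnum]

theorem isEtaCode_eq_zero {u : Term} (h : ∀ f, u ≠ app f (var 0)) :
    isEtaCode (gnum u + 2) = 0 := by
  cases u with
  | var n => simp [isEtaCode, gnum]
  | lam t => simp [isEtaCode, gnum]
  | app s t =>
    simp only [isEtaCode, gnum, Nat.add_sub_cancel, Nat.unpair_pair, if_true]
    rw [if_neg]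
    intro h'
    exact h s (by rw [gnum_injective (a₁ := t) (a₂ := var 0) h'])

theorem exists_etaAbs : ∃ F, F ⬝ num 0 = num 0 ∧ F ⬝ num 1 = num 1 ∧
    ∀ u, F ⬝ num (gnum u + 2) = num (gnum (etaAbs u) + 2) := by
  obtain ⟨C, hC⟩ := exists_case
  obtain ⟨Lw, hL⟩ := exists_lower
  obtain ⟨S, hS⟩ := exists_num_of_primrec primrec_isEtaCode
  obtain ⟨H, hH⟩ := exists_num_of_primrec₂ primrec₂_etaCode
  obtain ⟨A, hA⟩ := exists_num_of_primrec (f := fun c => (c - 2).unpair.2.unpair.1)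
    (primrec_unpair_fst.comp (primrec_unpair_snd.comp
      (Primrec.nat_sub.comp Primrec.id (Primrec.const 2))))
  obtain ⟨F, hF⟩ : ∃ F, ∀ c, F ⬝ c = C ⬝ c ⬝ num 0 ⬝ num 1 ⬝
      (C ⬝ (S ⬝ c) ⬝ (H ⬝ num 0 ⬝ c) ⬝ (H ⬝ (Lw ⬝ num 0 ⬝ (A ⬝ c)) ⬝ c) ⬝ num 0) :=
    ⟨ev (scons C (scons (num 0) (scons (num 1) (scons S (scons H (scons Lw (scons A triv)))))))
      (lam (app (app (app (app (var 1) (var 0)) (var 2)) (var 3))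
        (app (app (app (app (var 1) (app (var 4) (var 0))) (app (app (var 5) (var 2)) (var 0)))
          (app (app (var 5) (app (app (var 6) (var 2)) (app (var 7) (var 0)))) (var 0)))
            (var 2)))), fun c => by simp⟩
  refine ⟨F, by rw [hF, (hC _ _ _).1], by rw [hF, (hC _ _ _).2.1], fun u => ?_⟩
  rw [hF, (hC _ _ _).2.2, hS]
  by_cases h : ∃ f, u = app f (var 0)
  · obtain ⟨f, rfl⟩ := h
    rw [isEtaCode_app, (hC _ _ _).2.1, hA]
    simp only [gnum, Nat.add_sub_cancel, Nat.unpair_pair, hL, hH]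
    congr 1
    simp only [etaAbs, lowerCode, etaCode]
    rcases (lower 0 f).eq_none_or_eq_some with h | ⟨x, h⟩ <;> simp [h, gnum]
  · have h' : ∀ f, u ≠ app f (var 0) := fun f hf => h ⟨f, hf⟩
    rw [isEtaCode_eq_zero h', (hC _ _ _).1, hH]
    have : etaAbs u = lam u := by
      unfold etaAbs
      split
      · exact absurd rfl (h' _)
      · rfl
    rw [this]
    simp [etaCode, gnum]

theorem exists_appCode : ∃ F, ∀ (c d m : CA) (s t : Term), c ⬝ m = num (gnum s + 2) →
    d ⬝ m = num (gnum t + 2) → F ⬝ c ⬝ d ⬝ m = num (gnum (app s t) + 2) := by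
  have h : Primrec₂ fun a b : ℕ => Nat.pair 1 (Nat.pair (a - 2) (b - 2)) + 2 :=
    Primrec.nat_add.comp (Primrec₂.natPair.comp (Primrec.const 1) (Primrec₂.natPair.comp
      (Primrec.nat_sub.comp Primrec.fst (Primrec.const 2))
      (Primrec.nat_sub.comp Primrec.snd (Primrec.const 2)))) (Primrec.const 2)
  obtain ⟨P, hP⟩ := exists_num_of_primrec₂ h
  refine ⟨ev (scons P triv) (lam (lam (lam (app (app (var 3) (app (var 2) (var 0)))
    (app (var 1) (var 0)))))), fun c d m s t hc hd => ?_⟩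
  simp [hc, hd, hP, gnum]

theorem exists_varCode : ∃ F, ∀ l m : ℕ,
    F ⬝ num l ⬝ num m = num (gnum (var (m - 1 - l)) + 2) := by
  have h : Primrec₂ fun l m : ℕ => Nat.pair 0 (m - 1 - l) + 2 :=
    Primrec.nat_add.comp (Primrec₂.natPair.comp (Primrec.const 0)
      (Primrec.nat_sub.comp (Primrec.pred.comp Primrec.snd) Primrec.fst)) (Primrec.const 2)
  exact exists_num_of_primrec₂ h

/-- A combinator computing `etaAbs` on codes. -/
noncomputable def etaC : CA := exists_etaAbs.choose

theorem etaC_zero : etaC ⬝ num 0 = num 0 := exists_etaAbs.choose_spec.1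

theorem etaC_one : etaC ⬝ num 1 = num 1 := exists_etaAbs.choose_spec.2.1

theorem etaC_code (u : Term) : etaC ⬝ num (gnum u + 2) = num (gnum (etaAbs u) + 2) :=
  exists_etaAbs.choose_spec.2.2 u

/-- A combinator building codes of applications. -/
noncomputable def appC : CA := exists_appCode.choose

theorem appC_code {c d m : CA} {s t : Term} (hc : c ⬝ m = num (gnum s + 2))
    (hd : d ⬝ m = num (gnum t + 2)) : appC ⬝ c ⬝ d ⬝ m = num (gnum (app s t) + 2) :=
  exists_appCode.choose_spec c d m s t hc hd

/-- A combinator building codes of variables, given their level and the depth. -/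
noncomputable def varC : CA := exists_varCode.choose

theorem varC_code (l m : ℕ) : varC ⬝ num l ⬝ num m = num (gnum (var (m - 1 - l)) + 2) :=
  exists_varCode.choose_spec l m

/-- Case distinction. -/
noncomputable def caseC : CA := exists_case.choose

theorem caseC_zero (x y z : CA) : caseC ⬝ num 0 ⬝ x ⬝ y ⬝ z = x :=
  (exists_case.choose_spec x y z).1

theorem caseC_one (x y z : CA) : caseC ⬝ num 1 ⬝ x ⬝ y ⬝ z = y :=
  (exists_case.choose_spec x y z).2.1

theorem caseC_code (n : ℕ) (x y z : CA) : caseC ⬝ num (n + 2) ⬝ x ⬝ y ⬝ z = z :=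
  (exists_case.choose_spec x y z).2.2 n

/-- `absorb n ⬝ x` ignores `n` arguments and returns `x`. -/
noncomputable def absorb : ℕ → CA
  | 0 => I
  | n + 1 => ev (scons (absorb n) triv) (lam (lam (app (var 2) (var 1))))

theorem absorb_zero (x : CA) : absorb 0 ⬝ x = x := I_ap x

theorem absorb_succ (n : ℕ) (x y : CA) : absorb (n + 1) ⬝ x ⬝ y = absorb n ⬝ x := by
  simp [absorb]

/-- The argument which makes an object return its code. -/
noncomputable def endMark (p : ℕ) : CA := absorb (p + 2) ⬝ num 0

/-- The argument which makes an object swallow further arguments. -/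
noncomputable def skipMark (p : ℕ) : CA := absorb (p + 2) ⬝ num 1

/-- Read the code of an object by swallowing arguments. -/
noncomputable def readC (p : ℕ) : ℕ → CA
  | 0 => ev (scons (endMark p) triv) (lam (lam (app (app (var 1) (var 2)) (var 0))))
  | i + 1 => ev (scons (readC p i) (scons (skipMark p) triv))
      (lam (lam (app (app (var 2) (app (var 1) (var 3))) (var 0))))

/-- Read back the code of an object by applying it to fresh variables,
represented through `O`. -/
noncomputable def reifyC (p : ℕ) (O : CA) : ℕ → CA
  | 0 => ev (scons (endMark p) triv) (lam (lam (app (app (var 1) (var 2)) (var 0))))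
  | i + 1 => ev (scons (reifyC p O i) (scons etaC (scons O (scons varC (scons succ triv)))))
      (lam (lam (app (var 3) (app (app (var 2) (app (var 1) (app (var 4) (app (var 5) (var 0)))))
        (app (var 6) (var 0))))))

/-- Objects whose behaviour is controlled by a code, with arguments read by `q`. -/
theorem exists_reflect (p : ℕ) (q : CA) : ∃ O, ∀ c a, O ⬝ c ⬝ a =
    caseC ⬝ (q ⬝ a ⬝ num 0) ⬝ c ⬝ (absorb p ⬝ c) ⬝ (O ⬝ (appC ⬝ c ⬝ (q ⬝ a))) := by
  obtain ⟨O, hO⟩ := exists_fixpoint (ev (scons caseC (scons q (scons (num 0) (scons (absorb p)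
      (scons appC triv)))))
    (lam (lam (lam (app (app (app (app (var 3) (app (app (var 4) (var 0)) (var 5))) (var 1))
      (app (var 6) (var 1))) (app (var 2) (app (app (var 7) (var 1)) (app (var 4) (var 0)))))))))
  refine ⟨O, fun c a => ?_⟩
  conv_lhs => rw [← hO]
  simp

/-- A combinator as in `exists_reflect`. -/
noncomputable def reflectC (p : ℕ) (q : CA) : CA := (exists_reflect p q).choose

theorem reflectC_ap (p : ℕ) (q c a : CA) : reflectC p q ⬝ c ⬝ a =
    caseC ⬝ (q ⬝ a ⬝ num 0) ⬝ c ⬝ (absorb p ⬝ c) ⬝ (reflectC p q ⬝ (appC ⬝ c ⬝ (q ⬝ a))) :=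
  (exists_reflect p q).choose_spec c a

/-- The object combinators of each level. -/
noncomputable def obj (p : ℕ) : ℕ → CA
  | 0 => reflectC p (readC p p)
  | k + 1 => reflectC p (reifyC p (obj p k) p)

/-- The quoting combinators of each level. -/
noncomputable def quo (p : ℕ) : ℕ → ℕ → CA
  | 0 => readC p
  | k + 1 => reifyC p (obj p k)

theorem obj_ap (p k : ℕ) (c a : CA) : obj p k ⬝ c ⬝ a =
    caseC ⬝ (quo p k p ⬝ a ⬝ num 0) ⬝ c ⬝ (absorb p ⬝ c) ⬝
      (obj p k ⬝ (appC ⬝ c ⬝ (quo p k p ⬝ a))) := by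
  cases k <;> exact reflectC_ap _ _ _ _

theorem quo_zero (p k : ℕ) (a m : CA) : quo p k 0 ⬝ a ⬝ m = a ⬝ endMark p ⬝ m := by
  cases k <;> simp [quo, readC, reifyC]

theorem quo_zero_succ (p i : ℕ) (a m : CA) :
    quo p 0 (i + 1) ⬝ a ⬝ m = quo p 0 i ⬝ (a ⬝ skipMark p) ⬝ m := by
  simp [quo, readC]

theorem quo_succ_succ (p k i : ℕ) (a : CA) (m : ℕ) : quo p (k + 1) (i + 1) ⬝ a ⬝ num m =
    etaC ⬝ (quo p (k + 1) i ⬝ (a ⬝ (obj p k ⬝ (varC ⬝ num m))) ⬝ num (m + 1)) := by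
  simp [quo, reifyC]

theorem quo_absorb (p : ℕ) {x : CA} (hx : etaC ⬝ x = x) (k : ℕ) : ∀ i m,
    quo p k i ⬝ (absorb (i + 2) ⬝ x) ⬝ num m = x
  | 0, m => by rw [quo_zero, absorb_succ, absorb_succ, absorb_zero]
  | i + 1, m => by
    cases k with
    | zero => rw [quo_zero_succ, absorb_succ, quo_absorb p hx 0 i]
    | succ k => rw [quo_succ_succ, absorb_succ, quo_absorb p hx (k + 1) i, hx]

theorem obj_ap_endMark (p k : ℕ) (c : CA) : obj p k ⬝ c ⬝ endMark p = c := by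
  rw [obj_ap, endMark, quo_absorb p etaC_zero, caseC_zero]

theorem obj_ap_skipMark (p k : ℕ) (c : CA) : obj p k ⬝ c ⬝ skipMark p = absorb p ⬝ c := by
  rw [obj_ap, skipMark, quo_absorb p etaC_one, caseC_one]

theorem quo_zero_absorb (p : ℕ) (c m : CA) : ∀ i, quo p 0 i ⬝ (absorb (i + 1) ⬝ c) ⬝ m = c ⬝ m
  | 0 => by rw [quo_zero, absorb_succ, absorb_zero]
  | i + 1 => by rw [quo_zero_succ, absorb_succ, quo_zero_absorb p c m i]

theorem quo_zero_obj {p : ℕ} (hp : 0 < p) (j : ℕ) (c m : CA) :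
    quo p 0 p ⬝ (obj p j ⬝ c) ⬝ m = c ⬝ m := by
  obtain ⟨p, rfl⟩ := Nat.exists_eq_add_of_lt hp
  rw [Nat.zero_add, quo_zero_succ, obj_ap_skipMark, quo_zero_absorb]

/-! ### Codes of families of terms -/

/-- `c` yields the code of a term at every depth. -/
def IsCode (c : CA) : Prop := ∀ m, ∃ t, c ⬝ num m = num (gnum t + 2)

/-- At depths `m ≥ N`, `c` yields the code of a reduct of `t`, weakened to depth `m`. -/
def Codes (N : ℕ) (c : CA) (t : Term) : Prop :=
  ∀ m, N ≤ m → ∃ t', Red (lift (m - N) 0 t) t' ∧ c ⬝ num m = num (gnum t' + 2)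

theorem IsCode.congr {c d : CA} (h : IsCode c) (hcd : ∀ m, d ⬝ m = c ⬝ m) : IsCode d := by
  intro m
  rw [hcd]
  exact h m

theorem Codes.congr {N : ℕ} {c d : CA} {t : Term} (h : Codes N c t)
    (hcd : ∀ m, d ⬝ m = c ⬝ m) : Codes N d t := by
  intro m hm
  rw [hcd]
  exact h m hm

theorem IsCode.app {c d : CA} (hc : IsCode c) (hd : IsCode d) : IsCode (appC ⬝ c ⬝ d) := by
  intro m
  obtain ⟨s, hs⟩ := hc m
  obtain ⟨t, ht⟩ := hd m
  exact ⟨_, appC_code hs ht⟩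

theorem Codes.app {N : ℕ} {c d : CA} {s t : Term} (hc : Codes N c s) (hd : Codes N d t) :
    Codes N (appC ⬝ c ⬝ d) (Term.app s t) := by
  intro m hm
  obtain ⟨s', hs, hs'⟩ := hc m hm
  obtain ⟨t', ht, ht'⟩ := hd m hm
  exact ⟨_, hs.app ht, appC_code hs' ht'⟩

theorem Codes.lift {N N' : ℕ} {c : CA} {t : Term} (h : Codes N c t) (hN : N ≤ N') :
    Codes N' c (Term.lift (N' - N) 0 t) := by
  intro m hm
  obtain ⟨t', ht, ht'⟩ := h m (hN.trans hm)
  rw [lift_lift_zero, show N' - N + (m - N') = m - N by omega]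
  exact ⟨t', ht, ht'⟩

theorem Codes.of_red {N : ℕ} {c : CA} {s t : Term} (h : Codes N c t) (hs : Red s t) :
    Codes N c s := by
  intro m hm
  obtain ⟨t', ht, ht'⟩ := h m hm
  exact ⟨t', (hs.lift _ _).trans ht, ht'⟩

theorem isCode_varC (l : ℕ) : IsCode (varC ⬝ num l) := fun m => ⟨_, varC_code l m⟩

theorem codes_varC (l : ℕ) : Codes (l + 1) (varC ⬝ num l) (var 0) := by
  intro m hm
  refine ⟨_, Relation.ReflTransGen.refl, ?_⟩
  rw [varC_code, lift_zero_eq_ren]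
  simp only [ren]
  rw [show m - 1 - l = 0 + (m - (l + 1)) by omega]

theorem IsCode.quo_succ {p k i : ℕ} {a : CA}
    (h : ∀ m, IsCode (quo p (k + 1) i ⬝ (a ⬝ (obj p k ⬝ (varC ⬝ num m))))) :
    IsCode (quo p (k + 1) (i + 1) ⬝ a) := by
  intro m
  obtain ⟨t, ht⟩ := h m (m + 1)
  exact ⟨_, by rw [quo_succ_succ, ht, etaC_code]⟩

theorem Codes.quo_succ {p k i N : ℕ} {a : CA} {t : Term}
    (h : ∀ m, N ≤ m → Codes (m + 1) (quo p (k + 1) i ⬝ (a ⬝ (obj p k ⬝ (varC ⬝ num m))))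
      (Term.app (Term.lift (m + 1 - N) 0 t) (var 0))) :
    Codes N (quo p (k + 1) (i + 1) ⬝ a) t := by
  intro m hm
  obtain ⟨t', ht, ht'⟩ := h m hm (m + 1) le_rfl
  refine ⟨etaAbs t', ?_, by rw [quo_succ_succ, ht', etaC_code]⟩
  rw [Nat.sub_self, lift_zero_zero, show m + 1 - N = m - N + 1 by omega, ← lift_lift_zero] at ht
  exact ht.etaAbs_of_app_var

theorem obj_ap_of_isCode {p k : ℕ} {c a : CA} (h : IsCode (quo p k p ⬝ a)) :
    obj p k ⬝ c ⬝ a = obj p k ⬝ (appC ⬝ c ⬝ (quo p k p ⬝ a)) := by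
  obtain ⟨t, ht⟩ := h 0
  rw [obj_ap, ht, caseC_code]

/-- Quoting an object yields a code, and is faithful. -/
theorem quo_obj {p : ℕ} (hp : 0 < p) (n : ℕ) : ∀ {k j i : ℕ}, k + j = n → (k = 0 → i = p) →
    (∀ {c}, IsCode c → IsCode (quo p k i ⬝ (obj p j ⬝ c))) ∧
    ∀ {c N t}, IsCode c → Codes N c t → Codes N (quo p k i ⬝ (obj p j ⬝ c)) t := by
  induction n using Nat.strong_induction_on with
  | _ n IH =>
  intro k j i hn hi
  cases k with
  | zero =>
    rw [hi rfl]
    exact ⟨fun h => h.congr (quo_zero_obj hp j _), fun _ h => h.congr (quo_zero_obj hp j _)⟩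
  | succ k =>
    clear hi
    induction i with
    | zero =>
      have h : ∀ c m, quo p (k + 1) 0 ⬝ (obj p j ⬝ c) ⬝ m = c ⬝ m := fun c m => by
        rw [quo_zero, obj_ap_endMark]
      exact ⟨fun hc => hc.congr (h _), fun _ hc => hc.congr (h _)⟩
    | succ i ih =>
      have hq := IH (k + j) (by omega) (k := j) (j := k) (i := p) (Nat.add_comm _ _) fun _ => rfl
      have hv := fun m => hq.1 (isCode_varC m)
      constructor
      · intro c hc
        refine IsCode.quo_succ fun m => ?_
        rw [obj_ap_of_isCode (hv m)]
        exact ih.1 (hc.app (hv m))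
      · intro c N t hc ht
        refine Codes.quo_succ fun m hm => ?_
        rw [obj_ap_of_isCode (hv m)]
        exact ih.2 (hc.app (hv m)) ((ht.lift (by omega)).app (hq.2 (isCode_varC m) (codes_varC m)))

/-! ### Logical relations -/

/-- The environment with `N` variables, the one of level `l` being represented
by an object of level `κ l`. -/
noncomputable def world (p N : ℕ) (κ : ℕ → ℕ) : ℕ → CA := fun i =>
  if i < N then obj p (κ (N - 1 - i)) ⬝ (varC ⬝ num (N - 1 - i)) else I

theorem ev_world_lift {p N N' : ℕ} {κ κ' : ℕ → ℕ} (hN : N ≤ N') (hκ : ∀ l < N, κ' l = κ l)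
    (t : Term) : ev (world p N' κ') (lift (N' - N) 0 t) = ev (world p N κ) t := by
  rw [ev_lift]
  congr 1; funext i
  by_cases h : i < N
  · simp only [world]
    rw [if_pos h, if_pos (by omega), show N' - 1 - (i + (N' - N)) = N - 1 - i by omega,
      hκ _ (by omega)]
  · simp only [world]
    rw [if_neg h, if_neg (by omega)]

/-- The interpretation of types. -/
def Val (p : ℕ) : Ty → CA → Prop
  | .atom _, a => ∃ j c, a = obj p j ⬝ c ∧ IsCode c
  | .arrow A B, a => ∀ b, Val p A b → Val p B (a ⬝ b)
  | .inter A B, a => Val p A a ∧ Val p B a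

/-- The terms whose value faithfully represents them. -/
def Rel (p : ℕ) : Ty → ℕ → (ℕ → ℕ) → Term → Prop
  | .atom _, N, κ, t => ∃ j c, ev (world p N κ) t = obj p j ⬝ c ∧ IsCode c ∧ Codes N c t
  | .arrow A B, N, κ, t => ∀ N' κ' s, N ≤ N' → (∀ l < N, κ' l = κ l) →
      Val p A (ev (world p N' κ') s) → Rel p A N' κ' s →
      Rel p B N' κ' (Term.app (Term.lift (N' - N) 0 t) s)
  | .inter A B, N, κ, t => Rel p A N κ t ∧ Rel p B N κ t

theorem Val.of_sub {p : ℕ} {A B : Ty} (h : Ty.Sub A B) : ∀ {a}, Val p A a → Val p B a := by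
  induction h with
  | refl => exact id
  | trans _ _ ih ih' => exact fun h => ih' (ih h)
  | interL => exact And.left
  | interR => exact And.right
  | interGlb _ _ ih ih' => exact fun h => ⟨ih h, ih' h⟩
  | arrow _ _ ih ih' => exact fun h b hb => ih' (h b (ih hb))
  | dist => exact fun h b hb => ⟨h.1 b hb, h.2 b hb⟩

theorem Rel.of_sub {p : ℕ} {A B : Ty} (h : Ty.Sub A B) :
    ∀ {N κ t}, Rel p A N κ t → Rel p B N κ t := by
  induction h with
  | refl => exact id
  | trans _ _ ih ih' => exact fun h => ih' (ih h)
  | interL => exact And.left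
  | interR => exact And.right
  | interGlb _ _ ih ih' => exact fun h => ⟨ih h, ih' h⟩
  | arrow hA _ ih ih' =>
    exact fun h N' κ' s hN hκ hv hr => ih' (h N' κ' s hN hκ (hv.of_sub hA) (ih hr))
  | dist =>
    exact fun h N' κ' s hN hκ hv hr => ⟨h.1 N' κ' s hN hκ hv hr, h.2 N' κ' s hN hκ hv hr⟩

theorem Rel.lift {p : ℕ} {A : Ty} : ∀ {N N' κ κ' t}, Rel p A N κ t → N ≤ N' →
    (∀ l < N, κ' l = κ l) → Rel p A N' κ' (Term.lift (N' - N) 0 t) := by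
  induction A with
  | atom =>
    rintro N N' κ κ' t ⟨j, c, h, hc, hr⟩ hN hκ
    exact ⟨j, c, by rw [ev_world_lift hN hκ, h], hc, hr.lift hN⟩
  | arrow A B _ _ =>
    intro N N' κ κ' t h hN hκ N'' κ'' s hN' hκ' hv hr
    rw [lift_lift_zero, show N' - N + (N'' - N') = N'' - N by omega]
    exact h N'' κ'' s (hN.trans hN')
      (fun l hl => (hκ' l (hl.trans_le hN)).trans (hκ l hl)) hv hr
  | inter A B ihA ihB =>
    exact fun h hN hκ => ⟨ihA h.1 hN hκ, ihB h.2 hN hκ⟩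

theorem Rel.of_red {p : ℕ} {A : Ty} : ∀ {N κ s t}, Rel p A N κ t → Red s t →
    Rel p A N κ s := by
  induction A with
  | atom =>
    rintro N κ s t ⟨j, c, h, hc, hr⟩ hs
    exact ⟨j, c, by rw [ev_eq_of_conv hs.conv, h], hc, hr.of_red hs⟩
  | arrow A B _ ihB =>
    intro N κ s t h hs N' κ' u hN hκ hv hr
    exact ihB (h N' κ' u hN hκ hv hr) ((hs.lift _ _).app .refl)
  | inter A B ihA ihB =>
    exact fun h hs => ⟨ihA h.1 hs, ihB h.2 hs⟩

theorem val_ev {p : ℕ} {Γ : List Ty} {t : Term} {A : Ty} (d : Deriv Γ t A) :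
    ∀ {ρ : ℕ → CA}, (∀ n B, Γ[n]? = some B → Val p B (ρ n)) → Val p A (ev ρ t) := by
  induction d with
  | var Γ n A h =>
    intro ρ hρ
    rw [ev_var]
    exact hρ n A h
  | lam Γ t A B _ ih =>
    intro ρ hρ b hb
    rw [ev_lam_ap]
    refine ih fun n C hC => ?_
    cases n with
    | zero =>
      obtain rfl : A = C := by simpa using hC
      exact hb
    | succ n => exact hρ n C (by simpa using hC)
  | app Γ s t A B _ _ ih ih' => exact fun hρ => ih hρ _ (ih' hρ)
  | inter Γ t A B _ _ ih ih' => exact fun hρ => ⟨ih hρ, ih' hρ⟩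
  | sub Γ t A B _ h ih => exact fun hρ => (ih hρ).of_sub h

theorem rel_sub {p : ℕ} {Γ : List Ty} {t : Term} {A : Ty} (d : Deriv Γ t A) :
    ∀ {N : ℕ} {κ : ℕ → ℕ} {σ : ℕ → Term},
      (∀ n B, Γ[n]? = some B → Val p B (ev (world p N κ) (σ n)) ∧ Rel p B N κ (σ n)) →
      Rel p A N κ (Term.sub σ t) := by
  induction d with
  | var Γ n A h => exact fun hσ => (hσ n A h).2
  | lam Γ t A B _ ih =>
    intro N κ σ hσ N' κ' s hN hκ hv hr
    have hl : Term.lift (N' - N) 0 (Term.sub σ (Term.lam t)) =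
        Term.lam (Term.sub (up fun i => Term.lift (N' - N) 0 (σ i)) t) := by
      simp only [lift_zero_eq_ren]
      exact ren_sub (Term.lam t) _ _
    rw [hl]
    refine Rel.of_red ?_ (.single (Or.inl (Beta.beta _ _)))
    rw [subst_sub_up]
    refine ih fun n C hC => ?_
    cases n with
    | zero =>
      obtain rfl : A = C := by simpa using hC
      exact ⟨hv, hr⟩
    | succ n =>
      obtain ⟨h, h'⟩ := hσ n C (by simpa using hC)
      refine ⟨?_, h'.lift hN hκ⟩
      rw [scons_succ, ev_world_lift hN hκ]
      exact h
  | app Γ s t A B _ d' ih ih' =>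
    intro N κ σ hσ
    have h := ih hσ N κ (Term.sub σ t) le_rfl (fun _ _ => rfl)
      (by rw [ev_sub]; exact val_ev d' fun n B hB => (hσ n B hB).1) (ih' hσ)
    rwa [Nat.sub_self, lift_zero_zero] at h
  | inter Γ t A B _ _ ih ih' => exact fun hσ => ⟨ih hσ, ih' hσ⟩
  | sub Γ t A B _ h ih => exact fun hσ => (ih hσ).of_sub h

/-- A bound for the arities and the ranks in a type. -/
def size : Ty → ℕ
  | .atom _ => 0
  | .arrow A B => size A + size B + 1
  | .inter A B => size A + size B

theorem val_reflect_reify {p : ℕ} (hp : 0 < p) (A : Ty) : size A ≤ p →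
    (∀ {k c}, size A ≤ k → IsCode c → Val p A (obj p k ⬝ c)) ∧
    ∀ {k i a}, size A ≤ i → size A ≤ k + 1 → Val p A a → IsCode (quo p (k + 1) i ⬝ a) := by
  induction A with
  | atom x =>
    refine fun _ => ⟨fun {k c} _ hc => ⟨k, c, rfl, hc⟩, ?_⟩
    rintro k i a _ _ ⟨j, c, rfl, hc⟩
    exact (quo_obj hp _ rfl (fun h => absurd h k.succ_ne_zero)).1 hc
  | arrow A B ihA ihB =>
    intro hs
    simp only [size] at hs ⊢
    have hA := ihA (by omega)
    have hB := ihB (by omega)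
    constructor
    · intro k c hk hc a ha
      obtain ⟨k, rfl⟩ : ∃ l, k = l + 1 := ⟨k - 1, by omega⟩
      have h := hA.2 (k := k) (i := p) (by omega) (by omega) ha
      rw [obj_ap_of_isCode h]
      exact hB.1 (by omega) (hc.app h)
    · intro k i a hi hk ha
      obtain ⟨i, rfl⟩ : ∃ l, i = l + 1 := ⟨i - 1, by omega⟩
      exact IsCode.quo_succ fun m => hB.2 (by omega) (by omega)
        (ha _ (hA.1 (by omega) (isCode_varC m)))
  | inter A B ihA ihB =>
    intro hs
    simp only [size] at hs ⊢
    have hA := ihA (by omega)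
    have hB := ihB (by omega)
    exact ⟨fun hk hc => ⟨hA.1 (by omega) hc, hB.1 (by omega) hc⟩,
      fun hi hk ha => hA.2 (by omega) (by omega) ha.1⟩

theorem rel_reflect_reify {p : ℕ} (hp : 0 < p) (A : Ty) : size A ≤ p →
    (∀ {N κ t k c}, size A ≤ k → IsCode c → Codes N c t →
      ev (world p N κ) t = obj p k ⬝ c → Rel p A N κ t) ∧
    ∀ {N κ t k i}, size A ≤ i → size A ≤ k + 1 → Val p A (ev (world p N κ) t) →
      Rel p A N κ t → Codes N (quo p (k + 1) i ⬝ ev (world p N κ) t) t := by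
  induction A with
  | atom x =>
    refine fun _ => ⟨fun {N κ t k c} _ hc ht h => ⟨k, c, h, hc, ht⟩, ?_⟩
    rintro N κ t k i _ _ _ ⟨j, c, h, hc, hr⟩
    rw [h]
    exact (quo_obj hp _ rfl (fun h => absurd h k.succ_ne_zero)).2 hc hr
  | arrow A B ihA ihB =>
    intro hs
    simp only [size] at hs ⊢
    have hA := ihA (by omega)
    have hB := ihB (by omega)
    have hA' := val_reflect_reify hp A (by omega)
    constructor
    · intro N κ t k c hk hc ht h N' κ' s hN hκ hv hr
      obtain ⟨k, rfl⟩ : ∃ l, k = l + 1 := ⟨k - 1, by omega⟩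
      have hq := hA'.2 (k := k) (i := p) (by omega) (by omega) hv
      refine hB.1 (k := k + 1) (by omega) (hc.app hq)
        ((ht.lift hN).app (hA.2 (by omega) (by omega) hv hr)) ?_
      rw [ev_app, ev_world_lift hN hκ, h]
      exact obj_ap_of_isCode hq
    · intro N κ t k i hi hk hv hr
      obtain ⟨i, rfl⟩ : ∃ l, i = l + 1 := ⟨i - 1, by omega⟩
      refine Codes.quo_succ fun m hm => ?_
      have hκ : ∀ l < N, (fun l => if l < N then κ l else k) l = κ l := fun l hl => if_pos hl
      have hx : ev (world p (m + 1) fun l => if l < N then κ l else k) (var 0) =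
          obj p k ⬝ (varC ⬝ num m) := by
        simp [world, Nat.not_lt.2 hm]
      have hxv := hA'.1 (k := k) (by omega) (isCode_varC m)
      have hl := ev_world_lift (p := p) (show N ≤ m + 1 by omega) hκ t
      have h := hB.2 (k := k) (i := i) (by omega) (by omega)
        (by rw [ev_app, hl, hx]; exact hv _ hxv)
        (hr (m + 1) _ (var 0) (by omega) hκ (by rw [hx]; exact hxv)
          (hA.1 (by omega) (isCode_varC m) (codes_varC m) hx))
      rwa [ev_app, hl, hx] at h
  | inter A B ihA ihB =>
    intro hs
    simp only [size] at hs ⊢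
    have hA := ihA (by omega)
    have hB := ihB (by omega)
    exact ⟨fun hk hc ht h => ⟨hA.1 (by omega) hc ht h, hB.1 (by omega) hc ht h⟩,
      fun hi hk hv hr => hA.2 (by omega) (by omega) hv.1 hr.1⟩

theorem exists_quote (A : Ty) : ∃ F, ∀ t, ∀ ht : Closed t, BetaEtaNormal t → BCD [] t A →
    F ⬝ mk t ht = num (gnum t) := by
  have h2 : Primrec fun n : ℕ => n - 2 := Primrec.nat_sub.comp Primrec.id (Primrec.const 2)
  obtain ⟨P, hP⟩ := exists_num_of_primrec h2
  refine ⟨ev (scons P (scons (quo (size A + 1) (size A + 1) (size A + 1)) (scons (num 0) triv)))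
    (lam (app (var 1) (app (app (var 2) (var 0)) (var 3)))), fun t ht hn ⟨d⟩ => ?_⟩
  have hv : Val (size A + 1) A (ev (world (size A + 1) 0 id) t) := val_ev d (by simp)
  have hr : Rel (size A + 1) A 0 id (sub var t) := rel_sub d (by simp)
  rw [sub_var] at hr
  obtain ⟨t', h, h'⟩ := (rel_reflect_reify (Nat.succ_pos (size A)) A (Nat.le_succ _)).2
    (k := size A) (i := size A + 1) (Nat.le_succ _) (Nat.le_succ _) hv hr 0 le_rfl
  rw [lift_zero_zero] at h
  rw [h.eq_of_normal hn, ev_closed ht] at h'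
  simp [h', hP]

end CA

end Term

/-- Let `A` be an intersection type and `S` the set of closed terms
of type `A` in BCD.  The map taking a term of `S` to the Gödel number of its
beta-eta normal form is representable: there is a closed term `M` such that for
every closed beta-eta normal form `N` in `S`, `M N` beta-eta converts to the
Church numeral of the Gödel number of `N`. -/
theorem godel_number_representable (A : Ty) :
    ∃ M : Term, Term.Closed M ∧
      ∀ N : Term, Term.Closed N → Term.BetaEtaNormal N → BCD [] N A →
        Term.Conv (Term.app M N) (church (gnum N)) := by
  obtain ⟨F, hF⟩ := Term.CA.exists_quote A
  obtain ⟨M, hM, rfl⟩ := F.exists_mk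
  exact ⟨M, hM, fun N hN hn hd => Term.CA.mk_eq_mk.1 (hF N hN hn hd)⟩
end

section
/- (Tropical Lemma) If A ≤ B in the subtype preorder on intersection types, then for all natural number values of the atom variables, e(A) ≤ e(B). -/
/-- Along the subtype preorder the tropical evaluation increases at positive sign and
decreases at negative sign. -/
theorem Ty.Sub.te_le {A B : Ty} (h : Ty.Sub A B) (v : ℕ → ℕ) :
    Ty.te v true A ≤ Ty.te v true B ∧ Ty.te v false B ≤ Ty.te v false A := by
  induction h with
  | refl A => exact ⟨le_rfl, le_rfl⟩
  | trans _ _ ih₁ ih₂ => exact ⟨ih₁.1.trans ih₂.1, ih₂.2.trans ih₁.2⟩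
  | interL A B => simp [Ty.te]
  | interR A B => simp [Ty.te]
  | interGlb _ _ ih₁ ih₂ =>
    simpa [Ty.te] using ⟨⟨ih₁.1, ih₂.1⟩, ih₁.2, ih₂.2⟩
  | arrow _ _ ih₁ ih₂ =>
    simp only [Ty.te, Bool.not_true, Bool.not_false]
    omega
  | dist A B C =>
    simp only [Ty.te, Bool.not_true, Bool.not_false, if_true, Bool.false_eq_true, if_false]
    omega

/-- Tropical Lemma: If `A ≤ B` in the subtype preorder then for
all natural number values of the atom variables, `e(A) ≤ e(B)`. -/
theorem tropical_lemma (A B : Ty) (h : Ty.Sub A B) (v : ℕ → ℕ) :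
    Ty.te v true A ≤ Ty.te v true B := by
  exact (h.te_le v).1
end

section
/- For all natural number values of the atom variables: (i) if the context D(.) occurs strictly positively inside A, then e(A(D(B∧C))) = e(A(D(B)∧D(C))); (ii) if the context A(.) is positive then e(A(B∧C)) ≤ e(A(B)); and (iii) if the context A(.) is negative then e(A(B)) ≤ e(A(B∧C)). -/
/-- The value of a filled context is monotone in the value of the filling type, taken at the sign
of the hole. -/
theorem Ty.te_fill_mono (v : ℕ → ℕ) (E : Ctx) {X Y : Ty} (s : Bool)
    (h : Ty.te v (E.sign == s) X ≤ Ty.te v (E.sign == s) Y) :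
    Ty.te v s (E.fill X) ≤ Ty.te v s (E.fill Y) := by
  induction E generalizing s with
  | hole => simpa [Ctx.sign, Ctx.fill] using h
  | arrowL E A ih =>
    have := ih (!s) (by cases s <;> simpa [Ctx.sign] using h)
    simp only [Ctx.fill, Ty.te]
    omega
  | arrowR A E ih =>
    have := ih s h
    simp only [Ctx.fill, Ty.te]
    omega
  | interL E A ih =>
    have := ih s h
    cases s <;> simp only [Ctx.fill, Ty.te] <;> grind
  | interR A E ih =>
    have := ih s h
    cases s <;> simp only [Ctx.fill, Ty.te] <;> grind

/-- Strictly positive contexts distribute over intersections under tropical evaluation. -/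
theorem Ty.te_fill_inter (v : ℕ → ℕ) {D : Ctx} (hD : D.strictPos) (B C : Ty) (s : Bool) :
    Ty.te v s (D.fill (Ty.inter B C)) = Ty.te v s (Ty.inter (D.fill B) (D.fill C)) := by
  induction D with
  | hole => rfl
  | arrowL D A ih => exact hD.elim
  | arrowR A D ih | interL D A ih | interR A D ih =>
    have := ih hD
    cases s <;> simp only [Ctx.fill, Ty.te] at this ⊢ <;> grind

/-- For all natural number values of the atom variables:
(i) if the context `D(.)` occurs strictly positively inside `A` (here the outer
context is `E`), then `e(A(D(B∧C))) = e(A(D(B)∧D(C)))`;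
(ii) if the context `A(.)` is positive then `e(A(B∧C)) ≤ e(A(B))`;
(iii) if the context `A(.)` is negative then `e(A(B)) ≤ e(A(B∧C))`. -/
theorem tropical_facts (v : ℕ → ℕ) :
    (∀ (E D : Ctx) (B C : Ty), D.strictPos →
      Ty.te v true (E.fill (D.fill (Ty.inter B C))) =
        Ty.te v true (E.fill (Ty.inter (D.fill B) (D.fill C)))) ∧
    (∀ (E : Ctx) (B C : Ty), E.sign = true →
      Ty.te v true (E.fill (Ty.inter B C)) ≤ Ty.te v true (E.fill B)) ∧
    (∀ (E : Ctx) (B C : Ty), E.sign = false →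
      Ty.te v true (E.fill B) ≤ Ty.te v true (E.fill (Ty.inter B C))) := by
  refine ⟨fun E D B C hD => ?_, fun E B C hE => ?_, fun E B C hE => ?_⟩
  · exact le_antisymm (Ty.te_fill_mono v E true (Ty.te_fill_inter v hD B C _).le)
      (Ty.te_fill_mono v E true (Ty.te_fill_inter v hD B C _).ge)
  · exact Ty.te_fill_mono v E true (by simp [hE, Ty.te])
  · exact Ty.te_fill_mono v E true (by simp [hE, Ty.te])
end

section
/- (dnf Lemma) Suppose that A and F(x) for each x in dom(F) are intersection types in dist normal form, and F ⊢ X : A is derivable in BCD. Then there is a BCD derivation of F ⊢ X : A in which every type expression occurring in the derivation is in dist normal form. -/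
namespace Ty

/-- The dist normal form of `A → B`, for `A` and `B` in dist normal form. -/
def distArrow (A : Ty) : Ty → Ty
  | atom b => arrow A (atom b)
  | arrow B C => arrow A (arrow B C)
  | inter B C => inter (distArrow A B) (distArrow A C)

/-- The dist normal form of a type. -/
def dnf : Ty → Ty
  | atom a => atom a
  | arrow A B => distArrow (dnf A) (dnf B)
  | inter A B => inter (dnf A) (dnf B)

theorem distArrow_of_not_isInter (A : Ty) {B : Ty} (hB : ¬ IsInter B) :
    distArrow A B = arrow A B := by
  cases B with
  | atom b => rfl
  | arrow B C => rfl
  | inter B C => exact absurd trivial hB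

theorem Dnf.distArrow {A B : Ty} (hA : Dnf A) (hB : Dnf B) : Dnf (A.distArrow B) := by
  induction B with
  | atom b => exact ⟨hA, hB, id⟩
  | arrow B C => exact ⟨hA, hB, id⟩
  | inter B C ihB ihC => exact ⟨ihB hB.1, ihC hB.2⟩

theorem dnf_dnf (A : Ty) : Dnf (dnf A) := by
  induction A with
  | atom a => trivial
  | arrow A B ihA ihB => exact ihA.distArrow ihB
  | inter A B ihA ihB => exact ⟨ihA, ihB⟩

theorem Dnf.dnf_eq {A : Ty} (hA : Dnf A) : dnf A = A := by
  induction A with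
  | atom a => rfl
  | arrow A B ihA ihB =>
    rw [dnf, ihA hA.1, ihB hA.2.1, distArrow_of_not_isInter A hA.2.2]
  | inter A B ihA ihB => rw [dnf, ihA hA.1, ihB hA.2]

theorem Sub.inter_mono {A A' B B' : Ty} (hA : Sub A A') (hB : Sub B B') :
    Sub (inter A B) (inter A' B') :=
  .interGlb (.trans (.interL A B) hA) (.trans (.interR A B) hB)

theorem distArrow_sub_arrow (A B : Ty) : Sub (distArrow A B) (arrow A B) := by
  induction B with
  | atom b => exact .refl _
  | arrow B C => exact .refl _
  | inter B C ihB ihC => exact .trans (ihB.inter_mono ihC) (.dist A B C)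

theorem arrow_sub_distArrow (A B : Ty) : Sub (arrow A B) (distArrow A B) := by
  induction B with
  | atom b => exact .refl _
  | arrow B C => exact .refl _
  | inter B C ihB ihC =>
    exact .interGlb (.trans (.arrow (.refl A) (.interL B C)) ihB)
      (.trans (.arrow (.refl A) (.interR B C)) ihC)

theorem dnf_equiv (A : Ty) : Sub (dnf A) A ∧ Sub A (dnf A) := by
  induction A with
  | atom a => exact ⟨.refl _, .refl _⟩
  | arrow A B ihA ihB =>
    exact ⟨.trans (distArrow_sub_arrow _ _) (.arrow ihA.2 ihB.1),
      .trans (.arrow ihA.1 ihB.2) (arrow_sub_distArrow _ _)⟩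
  | inter A B ihA ihB => exact ⟨ihA.1.inter_mono ihB.1, ihA.2.inter_mono ihB.2⟩

theorem Sub.dnf {A B : Ty} (h : Sub A B) : Sub A.dnf B.dnf :=
  .trans (dnf_equiv A).1 (.trans h (dnf_equiv B).2)

end Ty

/-- Derivability by a derivation all of whose types are in dist normal form. -/
def DnfBCD (Γ : List Ty) (t : Term) (A : Ty) : Prop := ∃ d : Deriv Γ t A, d.allDnf

namespace DnfBCD

theorem inter {Γ : List Ty} {t : Term} {A B : Ty} (hA : DnfBCD Γ t A) (hB : DnfBCD Γ t B) :
    DnfBCD Γ t (Ty.inter A B) :=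
  let ⟨d, hd⟩ := hA
  let ⟨e, he⟩ := hB
  ⟨.inter Γ t A B d e, hd, he⟩

theorem sub {Γ : List Ty} {t : Term} {A B : Ty} (h : DnfBCD Γ t A) (hB : Ty.Dnf B)
    (hAB : Ty.Sub A B) : DnfBCD Γ t B :=
  let ⟨d, hd⟩ := h
  ⟨.sub Γ t A B d hAB, hB, hd⟩

theorem lam_of_not_isInter {Γ : List Ty} {t : Term} {A B : Ty} (hA : Ty.Dnf A) (hB : Ty.Dnf B)
    (hi : ¬ Ty.IsInter B) (h : DnfBCD (A :: Γ) t B) : DnfBCD Γ (Term.lam t) (Ty.arrow A B) :=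
  let ⟨d, hd⟩ := h
  ⟨.lam Γ t A B d, ⟨hA, hB, hi⟩, hd⟩

theorem app_arrow {Γ : List Ty} {s t : Term} {A B : Ty} (hs : DnfBCD Γ s (Ty.arrow A B))
    (ht : DnfBCD Γ t A) : DnfBCD Γ (Term.app s t) B :=
  let ⟨d, hd⟩ := hs
  let ⟨e, he⟩ := ht
  ⟨.app Γ s t A B d e, hd, he⟩

theorem lam {Γ : List Ty} {t : Term} {A B : Ty} (hA : Ty.Dnf A) (hB : Ty.Dnf B)
    (h : DnfBCD (A :: Γ) t B) : DnfBCD Γ (Term.lam t) (A.distArrow B) := by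
  induction B with
  | atom b => exact lam_of_not_isInter hA hB id h
  | arrow B C => exact lam_of_not_isInter hA hB id h
  | inter B C ihB ihC =>
    exact (ihB hB.1 (h.sub hB.1 (.interL B C))).inter (ihC hB.2 (h.sub hB.2 (.interR B C)))

theorem app {Γ : List Ty} {s t : Term} {A B : Ty} (hA : Ty.Dnf A) (hB : Ty.Dnf B)
    (hs : DnfBCD Γ s (A.distArrow B)) (ht : DnfBCD Γ t A) : DnfBCD Γ (Term.app s t) B := by
  induction B with
  | atom b => exact hs.app_arrow ht
  | arrow B C => exact hs.app_arrow ht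
  | inter B C ihB ihC =>
    exact (ihB hB.1 (hs.sub (hA.distArrow hB.1) (.interL _ _))).inter
      (ihC hB.2 (hs.sub (hA.distArrow hB.2) (.interR _ _)))

end DnfBCD

theorem ctxDnf_map_dnf (Γ : List Ty) : CtxDnf (Γ.map Ty.dnf) := by
  intro B hB
  obtain ⟨A, -, rfl⟩ := List.mem_map.mp hB
  exact A.dnf_dnf

theorem CtxDnf.map_dnf_eq {Γ : List Ty} (hΓ : CtxDnf Γ) : Γ.map Ty.dnf = Γ :=
  (List.map_congr_left fun B hB => (hΓ B hB).dnf_eq).trans (List.map_id' Γ)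

theorem Deriv.dnfBCD {Γ : List Ty} {t : Term} {A : Ty} (d : Deriv Γ t A) :
    DnfBCD (Γ.map Ty.dnf) t A.dnf := by
  induction d with
  | var Γ n A h =>
    have hn : (Γ.map Ty.dnf)[n]? = some A.dnf := by simp [h]
    exact ⟨.var _ n A.dnf hn, ctxDnf_map_dnf Γ, A.dnf_dnf⟩
  | lam Γ t A B _ ih => exact .lam A.dnf_dnf B.dnf_dnf ih
  | app Γ s t A B _ _ ihs iht => exact .app A.dnf_dnf B.dnf_dnf ihs iht
  | inter Γ t A B _ _ ihA ihB => exact ihA.inter ihB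
  | sub Γ t A B _ hAB ih => exact ih.sub B.dnf_dnf hAB.dnf

/-- dnf Lemma: If `A` and all types of the basis `Γ` are in dist
normal form and `Γ ⊢ X : A` is derivable in BCD, then there is a derivation of
`Γ ⊢ X : A` in which every type expression is in dist normal form. -/
theorem dnf_lemma (Γ : List Ty) (X : Term) (A : Ty)
    (hΓ : CtxDnf Γ) (hA : Ty.Dnf A) (h : BCD Γ X A) :
    ∃ d : Deriv Γ X A, d.allDnf := by
  obtain ⟨d⟩ := h
  have hd := d.dnfBCD
  rwa [hΓ.map_dnf_eq, hA.dnf_eq] at hd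
end

section
/- (Predicate Reduction) Suppose P is a BCD derivation of F ⊢ X : A in which every type expression is in dist normal form. Then there exists a BCD derivation of F ⊢ X : A in which every type expression is in dist normal form and every application of the subtyping rule (≤) has a variable as its subject. -/
namespace Ty

/-- The strict (non-intersection) components of a type, with intersections in the
codomain of an arrow distributed over the arrow. -/
def comps : Ty → List Ty
  | atom a => [atom a]
  | arrow A B => (comps B).map (arrow A)
  | inter A B => comps A ++ comps B

/-- Subtyping between strict types. -/
inductive StrictSub : Ty → Ty → Prop
  | atom (a : ℕ) : StrictSub (atom a) (atom a)
  | arrow {A A' b b' : Ty} : Sub A' A → StrictSub b b' →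
      StrictSub (arrow A b) (arrow A' b')

theorem StrictSub.sub {a b : Ty} (h : StrictSub a b) : Sub a b := by
  induction h with
  | atom a => exact .refl _
  | arrow h _ ih => exact .arrow h ih

theorem StrictSub.not_isInter {a b : Ty} (h : StrictSub a b) : ¬ IsInter b := by
  cases h <;> exact id

theorem StrictSub.trans {a b c : Ty} (h : StrictSub a b) (h' : StrictSub b c) :
    StrictSub a c := by
  induction h generalizing c with
  | atom => exact h'
  | arrow h _ ih =>
    cases h' with
    | arrow k k' => exact .arrow (k.trans h) (ih k')

theorem StrictSub.refl_of_mem_comps {A b : Ty} (h : b ∈ comps A) : StrictSub b b := by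
  induction A generalizing b with
  | atom a =>
    obtain rfl := List.mem_singleton.1 h
    exact .atom a
  | arrow A B _ ih =>
    obtain ⟨b, hb, rfl⟩ := List.mem_map.1 h
    exact .arrow (.refl A) (ih hb)
  | inter A B ihA ihB => exact (List.mem_append.1 h).elim ihA ihB

theorem Sub.exists_strictSub {A B : Ty} (h : Sub A B) :
    ∀ b ∈ comps B, ∃ a ∈ comps A, StrictSub a b := by
  induction h with
  | refl A => exact fun b hb => ⟨b, hb, .refl_of_mem_comps hb⟩
  | trans _ _ ih₁ ih₂ =>
    intro c hc
    obtain ⟨b, hb, hbc⟩ := ih₂ c hc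
    obtain ⟨a, ha, hab⟩ := ih₁ b hb
    exact ⟨a, ha, hab.trans hbc⟩
  | interL A B =>
    exact fun b hb => ⟨b, List.mem_append_left _ hb, .refl_of_mem_comps hb⟩
  | interR A B =>
    exact fun b hb => ⟨b, List.mem_append_right _ hb, .refl_of_mem_comps hb⟩
  | interGlb _ _ ih₁ ih₂ =>
    exact fun b hb => (List.mem_append.1 hb).elim (ih₁ b) (ih₂ b)
  | arrow h _ _ ih =>
    intro _ hb
    obtain ⟨b, hb', rfl⟩ := List.mem_map.1 hb
    obtain ⟨d, hd, hdb⟩ := ih b hb'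
    exact ⟨_, List.mem_map_of_mem hd, .arrow h hdb⟩
  | dist A B C =>
    intro b hb
    refine ⟨b, ?_, .refl_of_mem_comps hb⟩
    simpa [comps] using hb

theorem comps_eq_singleton {A : Ty} (h : Dnf A) (h' : ¬ IsInter A) : comps A = [A] := by
  induction A with
  | atom a => rfl
  | arrow A B _ ih => simp [comps, ih h.2.1 h.2.2]
  | inter A B => exact (h' trivial).elim

theorem Dnf.of_mem_comps {A a : Ty} (h : Dnf A) (ha : a ∈ comps A) : Dnf a := by
  induction A with
  | inter A B ihA ihB => exact (List.mem_append.1 ha).elim (ihA h.1) (ihB h.2)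
  | _ =>
    rw [comps_eq_singleton h id] at ha
    exact List.mem_singleton.1 ha ▸ h

end Ty

/-- Derivability by derivations in dist normal form in which subtyping is applied
only to variables. -/
inductive VarSubDerivable : List Ty → Term → Ty → Prop
  | var {Γ : List Ty} {n : ℕ} {A B : Ty} : CtxDnf Γ → Γ[n]? = some A → Ty.Sub A B →
      Ty.Dnf B → VarSubDerivable Γ (.var n) B
  | lam {Γ : List Ty} {t : Term} {A B : Ty} : Ty.Dnf (.arrow A B) →
      VarSubDerivable (A :: Γ) t B → VarSubDerivable Γ (.lam t) (.arrow A B)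
  | app {Γ : List Ty} {s t : Term} {A B : Ty} : VarSubDerivable Γ s (.arrow A B) →
      VarSubDerivable Γ t A → VarSubDerivable Γ (.app s t) B
  | inter {Γ : List Ty} {t : Term} {A B : Ty} : VarSubDerivable Γ t A →
      VarSubDerivable Γ t B → VarSubDerivable Γ t (.inter A B)

namespace VarSubDerivable

theorem exists_deriv {Γ : List Ty} {t : Term} {A : Ty} (h : VarSubDerivable Γ t A) :
    ∃ Q : Deriv Γ t A, Q.allDnf ∧ Q.subOnVar := by
  induction h with
  | @var Γ n A B hΓ hn hAB hB =>
    exact ⟨.sub _ _ _ _ (.var _ _ _ hn) hAB,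
      ⟨hB, hΓ, hΓ _ (List.mem_of_getElem? hn)⟩, ⟨n, rfl⟩, trivial⟩
  | lam hAB _ ih =>
    obtain ⟨Q, hQ, hQ'⟩ := ih
    exact ⟨.lam _ _ _ _ Q, ⟨hAB, hQ⟩, hQ'⟩
  | app _ _ ih₁ ih₂ =>
    obtain ⟨Q₁, h₁, h₁'⟩ := ih₁
    obtain ⟨Q₂, h₂, h₂'⟩ := ih₂
    exact ⟨.app _ _ _ _ _ Q₁ Q₂, ⟨h₁, h₂⟩, h₁', h₂'⟩
  | inter _ _ ih₁ ih₂ =>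
    obtain ⟨Q₁, h₁, h₁'⟩ := ih₁
    obtain ⟨Q₂, h₂, h₂'⟩ := ih₂
    exact ⟨.inter _ _ _ _ Q₁ Q₂, ⟨h₁, h₂⟩, h₁', h₂'⟩

theorem dnf {Γ : List Ty} {t : Term} {A : Ty} (h : VarSubDerivable Γ t A) : A.Dnf := by
  induction h with
  | var _ _ _ hB => exact hB
  | lam hAB => exact hAB
  | app _ _ ih => exact ih.2.1
  | inter _ _ ih₁ ih₂ => exact ⟨ih₁, ih₂⟩

theorem ctxDnf {Γ : List Ty} {t : Term} {A : Ty} (h : VarSubDerivable Γ t A) :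
    CtxDnf Γ := by
  induction h with
  | var hΓ => exact hΓ
  | lam _ _ ih => exact fun B hB => ih B (List.mem_cons_of_mem _ hB)
  | app _ _ ih => exact ih
  | inter _ _ ih => exact ih

theorem of_inter {Γ : List Ty} {t : Term} {A B : Ty}
    (h : VarSubDerivable Γ t (.inter A B)) :
    VarSubDerivable Γ t A ∧ VarSubDerivable Γ t B := by
  cases h with
  | var hΓ hn hs hd =>
    exact ⟨.var hΓ hn (hs.trans (.interL _ _)) hd.1, .var hΓ hn (hs.trans (.interR _ _)) hd.2⟩
  | app h₁ h₂ => exact (h₁.dnf.2.2 trivial).elim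
  | inter h₁ h₂ => exact ⟨h₁, h₂⟩

theorem of_mem_comps {Γ : List Ty} {t : Term} {A a : Ty} (h : VarSubDerivable Γ t A)
    (ha : a ∈ A.comps) : VarSubDerivable Γ t a := by
  induction A with
  | inter A B ihA ihB =>
    exact (List.mem_append.1 ha).elim (ihA h.of_inter.1) (ihB h.of_inter.2)
  | _ =>
    rw [Ty.comps_eq_singleton h.dnf id] at ha
    exact List.mem_singleton.1 ha ▸ h

theorem of_forall_comps {Γ : List Ty} {t : Term} {A : Ty} (hA : A.Dnf)
    (h : ∀ a ∈ A.comps, VarSubDerivable Γ t a) : VarSubDerivable Γ t A := by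
  induction A with
  | inter A B ihA ihB =>
    exact .inter (ihA hA.1 fun a ha => h a (List.mem_append_left _ ha))
      (ihB hA.2 fun a ha => h a (List.mem_append_right _ ha))
  | _ => exact h _ (by simp [Ty.comps_eq_singleton hA id])

theorem narrow {Γ Γ' : List Ty} {t : Term} {A : Ty} (h : VarSubDerivable Γ t A)
    (hΓ' : CtxDnf Γ') (hs : List.Forall₂ Ty.Sub Γ' Γ) : VarSubDerivable Γ' t A := by
  induction h generalizing Γ' with
  | @var Γ n A B hΓ hn hAB hB =>
    obtain ⟨hlt, rfl⟩ := List.getElem?_eq_some_iff.1 hn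
    have hlt' : n < Γ'.length := hs.length_eq ▸ hlt
    exact .var hΓ' (List.getElem?_eq_getElem hlt')
      ((List.forall₂_iff_get.1 hs).2 n hlt' hlt |>.trans hAB) hB
  | lam hAB _ ih =>
    exact .lam hAB (ih (List.forall_mem_cons.2 ⟨hAB.1, hΓ'⟩) (.cons (.refl _) hs))
  | app _ _ ih₁ ih₂ => exact .app (ih₁ hΓ' hs) (ih₂ hΓ' hs)
  | inter _ _ ih₁ ih₂ => exact .inter (ih₁ hΓ' hs) (ih₂ hΓ' hs)

theorem sub {Γ : List Ty} {t : Term} {A B : Ty} (h : VarSubDerivable Γ t A)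
    (hs : Ty.Sub A B) (hB : B.Dnf) : VarSubDerivable Γ t B := by
  induction t generalizing Γ A B with
  | var n =>
    refine of_forall_comps hB fun b hb => ?_
    obtain ⟨a, ha, hab⟩ := hs.exists_strictSub b hb
    have hbd := hB.of_mem_comps hb
    cases h.of_mem_comps ha with
    | var hΓ hn hs' _ => exact .var hΓ hn (hs'.trans hab.sub) hbd
    | inter => cases hab
  | app s t ihs _ =>
    refine of_forall_comps hB fun b hb => ?_
    obtain ⟨a, ha, hab⟩ := hs.exists_strictSub b hb
    have hbd := hB.of_mem_comps hb
    cases h.of_mem_comps ha with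
    | app h₁ h₂ =>
      exact .app (ihs h₁ (.arrow (.refl _) hab.sub) ⟨h₂.dnf, hbd, hab.not_isInter⟩) h₂
    | inter => cases hab
  | lam t ih =>
    refine of_forall_comps hB fun b hb => ?_
    obtain ⟨a, ha, hab⟩ := hs.exists_strictSub b hb
    have hbd := hB.of_mem_comps hb
    have hΓ := h.ctxDnf
    cases h.of_mem_comps ha with
    | lam hd h' =>
      cases hab with
      | arrow hA hb' =>
        refine .lam hbd (ih (h'.narrow (List.forall_mem_cons.2 ⟨hbd.1, hΓ⟩)
          (.cons hA (List.forall₂_same.2 fun C _ => .refl C))) hb'.sub hbd.2.1)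
    | inter => cases hab

end VarSubDerivable

theorem Deriv.varSubDerivable {Γ : List Ty} {t : Term} {A : Ty} (P : Deriv Γ t A)
    (hP : P.allDnf) : VarSubDerivable Γ t A := by
  induction P with
  | var Γ n A hn => exact .var hP.1 hn (.refl A) hP.2
  | lam _ _ _ _ _ ih => exact .lam hP.1 (ih hP.2)
  | app _ _ _ _ _ _ _ ih₁ ih₂ => exact .app (ih₁ hP.1) (ih₂ hP.2)
  | inter _ _ _ _ _ _ ih₁ ih₂ => exact .inter (ih₁ hP.1) (ih₂ hP.2)
  | sub _ _ _ _ _ hs ih => exact (ih hP.2).sub hs hP.1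

/-- Predicate Reduction: If `P` is a BCD derivation of `Γ ⊢ X : A`
in which every type expression is in dist normal form, then there is a
derivation of `Γ ⊢ X : A` in which every type expression is in dist normal form
and every application of the rule (≤) has a variable as its subject. -/
theorem predicate_reduction (Γ : List Ty) (X : Term) (A : Ty)
    (P : Deriv Γ X A) (hP : P.allDnf) :
    ∃ Q : Deriv Γ X A, Q.allDnf ∧ Q.subOnVar :=
  (P.varSubDerivable hP).exists_deriv
end
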